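/- Let Δ = (T, 𝒮, ℬ) be a strong triangle blocking arrangement with vertices x₁, x₂, x₃ of T, and suppose that no blocking segment passes through x₁. Let s₁, s₂ ∈ 𝒮 be two proper initial segments, each having one endpoint on the edge x₁x₂ and the other endpoint on the edge x₁x₃. Then s₁ and s₂ are disjoint. -/

import Mathlib

open Set

noncomputable section

/-- Points of the real plane. -/
abbrev Pt := ℝ × ℝ

/-- The boundary of the triangle with vertices `x1`, `x2`, `x3`:
the union of its three edges. -/
def triBdry (x1 x2 x3 : Pt) : Set Pt :=
  segment ℝ x1 x2 ∪ segment ℝ x2 x3 ∪ segment ℝ x3 x1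

/-- The three edges of the triangle with vertices `x1`, `x2`, `x3`. -/
def triEdges (x1 x2 x3 : Pt) : Set (Set Pt) :=
  {segment ℝ x1 x2, segment ℝ x2 x3, segment ℝ x3 x1}

/-- A triangle blocking arrangement: a nondegenerate triangle `x1 x2 x3` together with two
finite collections `S` (proper initial segments) and `B` (blocking segments) of closed
segments with endpoints on the boundary of the triangle and no interior point on the
boundary, satisfying the intersection conditions (i) and (ii). `S ∪ triEdges x1 x2 x3`
is the collection of initial segments `𝒮̄`. -/
structure TBA where
  x1 : Pt
  x2 : Pt
  x3 : Pt
  S : Set (Set Pt)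
  B : Set (Set Pt)
  indep : AffineIndependent ℝ ![x1, x2, x3]
  finS : S.Finite
  finB : B.Finite
  seg_wf : ∀ s ∈ S ∪ B, ∃ a b : Pt, a ≠ b ∧ s = segment ℝ a b ∧
    a ∈ triBdry x1 x2 x3 ∧ b ∈ triBdry x1 x2 x3 ∧
    ∀ p ∈ openSegment ℝ a b, p ∉ triBdry x1 x2 x3
  /- (i) no three initial segments are concurrent … -/
  no_three_concurrent : ∀ s₁ ∈ S ∪ triEdges x1 x2 x3, ∀ s₂ ∈ S ∪ triEdges x1 x2 x3,
    ∀ s₃ ∈ S ∪ triEdges x1 x2 x3, s₁ ≠ s₂ → s₁ ≠ s₃ → s₂ ≠ s₃ →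
    ¬ ∃ p : Pt, p ∈ s₁ ∧ p ∈ s₂ ∧ p ∈ s₃
  /- … and through every intersection point of two initial segments, not both edges,
  there is a unique blocking segment … -/
  block_exists : ∀ s₁ ∈ S ∪ triEdges x1 x2 x3, ∀ s₂ ∈ S ∪ triEdges x1 x2 x3, s₁ ≠ s₂ →
    ¬ (s₁ ∈ triEdges x1 x2 x3 ∧ s₂ ∈ triEdges x1 x2 x3) →
    ∀ p : Pt, p ∈ s₁ → p ∈ s₂ → ∃! b, b ∈ B ∧ p ∈ b
  /- … while through an intersection point of two edges there is at most one
  blocking segment. -/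
  block_unique : ∀ s₁ ∈ S ∪ triEdges x1 x2 x3, ∀ s₂ ∈ S ∪ triEdges x1 x2 x3, s₁ ≠ s₂ →
    ∀ p : Pt, p ∈ s₁ → p ∈ s₂ → ∀ b₁ ∈ B, ∀ b₂ ∈ B, p ∈ b₁ → p ∈ b₂ → b₁ = b₂
  /- (ii) through every intersection point of an initial segment and a blocking segment
  there is a unique second initial segment. -/
  second_segment : ∀ s ∈ S ∪ triEdges x1 x2 x3, ∀ b ∈ B, ∀ p : Pt, p ∈ s → p ∈ b →
    ∃! s', s' ∈ S ∪ triEdges x1 x2 x3 ∧ s' ≠ s ∧ p ∈ s'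

namespace TBA

variable (Δ : TBA)

/-- The collection `𝒮̄` of initial segments. -/
def Sbar : Set (Set Pt) := Δ.S ∪ triEdges Δ.x1 Δ.x2 Δ.x3

/-- The (closed) triangle `T`. -/
def tri : Set Pt := convexHull ℝ {Δ.x1, Δ.x2, Δ.x3}

/-- The boundary `∂T`. -/
def bdry : Set Pt := triBdry Δ.x1 Δ.x2 Δ.x3

/-- A vertex of the arrangement: an intersection point of two initial segments. -/
def IsVertex (p : Pt) : Prop :=
  ∃ s₁ ∈ Δ.Sbar, ∃ s₂ ∈ Δ.Sbar, s₁ ≠ s₂ ∧ p ∈ s₁ ∧ p ∈ s₂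

/-- The segment `xy` is minimal if no vertex of the arrangement lies in its interior. -/
def MinimalSeg (x y : Pt) : Prop :=
  ∀ p ∈ openSegment ℝ x y, ¬ Δ.IsVertex p

/-- An `𝒮̄`-region: the closure of a connected component of `T \ ⋃ L` for some
subset `L` of `𝒮̄`. -/
def IsRegion (R : Set Pt) : Prop :=
  ∃ L ⊆ Δ.Sbar, ∃ p ∈ Δ.tri \ ⋃₀ L,
    R = closure (connectedComponentIn (Δ.tri \ ⋃₀ L) p)

/-- A minimal `𝒮̄`-region: the closure of a connected component of `T \ ⋃ 𝒮̄`. -/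
def IsMinRegion (R : Set Pt) : Prop :=
  ∃ p ∈ Δ.tri \ ⋃₀ Δ.Sbar,
    R = closure (connectedComponentIn (Δ.tri \ ⋃₀ Δ.Sbar) p)

/-- The set `s` contains an edge of the region `R`: it contains a nondegenerate
segment lying on the boundary of `R`. -/
def ContainsEdgeOf (_Δ : TBA) (s R : Set Pt) : Prop :=
  ∃ q₁ q₂ : Pt, q₁ ≠ q₂ ∧ segment ℝ q₁ q₂ ⊆ s ∩ frontier R

/-- A vertex of the region `R`: a point of `R` that is the intersection of two initial
segments, each containing an edge of `R`. -/
def IsRegionVertex (R : Set Pt) (p : Pt) : Prop :=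
  p ∈ R ∧ ∃ s₁ ∈ Δ.Sbar, ∃ s₂ ∈ Δ.Sbar, s₁ ≠ s₂ ∧ p ∈ s₁ ∧ p ∈ s₂ ∧
    Δ.ContainsEdgeOf s₁ R ∧ Δ.ContainsEdgeOf s₂ R

/-- A vertex `p` is internally blocked in the region `R` if the blocking segment
through `p` exists and meets the interior of `R`.  (Externally blocked means not
internally blocked.) -/
def InternallyBlocked (R : Set Pt) (p : Pt) : Prop :=
  ∃ b ∈ Δ.B, p ∈ b ∧ (b ∩ interior R).Nonempty

/-- Two consecutive vertices of a region `R`: distinct vertices joined by an edge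
lying on the boundary of `R`. -/
def Consec (R : Set Pt) (u v : Pt) : Prop :=
  u ≠ v ∧ Δ.IsRegionVertex R u ∧ Δ.IsRegionVertex R v ∧ segment ℝ u v ⊆ frontier R

/-- Condition (A): the arrangement is strong when for every minimal `𝒮̄`-region `R` and
consecutive vertices `v₁, v₂, v₃, v₄, v₅` in this order along `∂R`, if the line
`l(v₁v₂)` and the blocking segment `β(v₃)` intersect inside `T`, and `β(v₃)` meets the
interior of `R`, then `l(v₁v₂)`, `β(v₃)` and `l(v₄v₅)` are concurrent. -/
def Strong : Prop :=
  ∀ R : Set Pt, Δ.IsMinRegion R →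
  ∀ v₁ v₂ v₃ v₄ v₅ : Pt, List.Pairwise (· ≠ ·) [v₁, v₂, v₃, v₄, v₅] →
    Δ.Consec R v₁ v₂ → Δ.Consec R v₂ v₃ → Δ.Consec R v₃ v₄ → Δ.Consec R v₄ v₅ →
    ∀ b ∈ Δ.B, v₃ ∈ b → (b ∩ interior R).Nonempty →
    (∃ q ∈ Δ.tri, q ∈ affineSpan ℝ ({v₁, v₂} : Set Pt) ∧ q ∈ b) →
    ∃ q : Pt, q ∈ b ∧ q ∈ affineSpan ℝ ({v₁, v₂} : Set Pt) ∧
      q ∈ affineSpan ℝ ({v₄, v₅} : Set Pt)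

end TBA

/-- The affine function on the plane with coefficients `c`. -/
def ev (c : ℝ × ℝ × ℝ) (p : Pt) : ℝ := c.1 * p.1 + c.2.1 * p.2 + c.2.2

theorem ev_comb (c : ℝ × ℝ × ℝ) {a b : ℝ} (h : a + b = 1) (u v : Pt) :
    ev c (a • u + b • v) = a * ev c u + b * ev c v := by
  simp only [ev, Prod.fst_add, Prod.snd_add, Prod.smul_fst, Prod.smul_snd, smul_eq_mul]
  linear_combination (c.2.2 : ℝ) * (-h)

theorem continuous_ev (c : ℝ × ℝ × ℝ) : Continuous (ev c) := by
  unfold ev; fun_prop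

/-- A nonconstant affine function vanishing at two distinct points determines the line
through them. -/
theorem ev_eq_zero_of_two {c d : ℝ × ℝ × ℝ} (hc : c.1 ≠ 0 ∨ c.2.1 ≠ 0) {u v p : Pt} (huv : u ≠ v)
    (hu : ev c u = 0) (hv : ev c v = 0) (hu' : ev d u = 0) (hv' : ev d v = 0)
    (hp : ev c p = 0) : ev d p = 0 := by
  obtain ⟨α, β, γ⟩ := c
  obtain ⟨α', β', γ'⟩ := d
  obtain ⟨u1, u2⟩ := u
  obtain ⟨v1, v2⟩ := v
  obtain ⟨p1, p2⟩ := p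
  simp only [ev] at *
  have h1 : (α * β' - β * α') * (u1 - v1) = 0 := by
    linear_combination β' * (hu - hv) - β * (hu' - hv')
  have h2 : (α * β' - β * α') * (u2 - v2) = 0 := by
    linear_combination α * (hu' - hv') - α' * (hu - hv)
  have h3 : α * β' - β * α' = 0 := by
    by_contra h
    apply huv
    rw [Prod.mk.injEq]
    exact ⟨sub_eq_zero.1 ((mul_eq_zero.1 h1).resolve_left h),
      sub_eq_zero.1 ((mul_eq_zero.1 h2).resolve_left h)⟩
  rcases hc with hc | hc
  · apply (mul_eq_zero.1 (?_ : α * _ = 0)).resolve_left hc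
    linear_combination α' * (hp - hu) + α * hu' + h3 * (p2 - u2)
  · apply (mul_eq_zero.1 (?_ : β * _ = 0)).resolve_left hc
    linear_combination β' * (hp - hu) + β * hu' - h3 * (p1 - u1)

theorem mem_affineSpan_of_ev {c : ℝ × ℝ × ℝ} (hc : c.1 ≠ 0 ∨ c.2.1 ≠ 0) {u v p : Pt} (huv : u ≠ v)
    (hu : ev c u = 0) (hv : ev c v = 0) (hp : ev c p = 0) :
    p ∈ affineSpan ℝ ({u, v} : Set Pt) := by
  have key : (v.2 - u.2) * (p.1 - u.1) - (v.1 - u.1) * (p.2 - u.2) = 0 := by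
    have := ev_eq_zero_of_two (d := (v.2 - u.2, -(v.1 - u.1),
      -(v.2 - u.2) * u.1 + (v.1 - u.1) * u.2)) hc huv hu hv
      (by simp only [ev]; ring) (by simp only [ev]; ring) hp
    simp only [ev] at this
    linear_combination this
  obtain ⟨u1, u2⟩ := u
  obtain ⟨v1, v2⟩ := v
  obtain ⟨p1, p2⟩ := p
  simp only at key
  have hN : (v1 - u1) ^ 2 + (v2 - u2) ^ 2 ≠ 0 := by
    intro h
    apply huv
    rw [Prod.mk.injEq]
    constructor <;> nlinarith [sq_nonneg (v1 - u1), sq_nonneg (v2 - u2)]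
  have : (p1, p2) = AffineMap.lineMap (k := ℝ) ((u1, u2) : Pt) ((v1, v2) : Pt)
      (((v1 - u1) * (p1 - u1) + (v2 - u2) * (p2 - u2)) / ((v1 - u1) ^ 2 + (v2 - u2) ^ 2)) := by
    rw [AffineMap.lineMap_apply]
    simp only [vsub_eq_sub, vadd_eq_add, Prod.mk_sub_mk, Prod.smul_mk, smul_eq_mul,
      Prod.mk_add_mk, Prod.mk.injEq]
    constructor
    · field_simp
      linear_combination (v2 - u2) * key
    · field_simp
      linear_combination -(v1 - u1) * key
  rw [this]
  exact AffineMap.lineMap_mem_affineSpan_pair _ _ _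

theorem ev_of_mem_affineSpan {c : ℝ × ℝ × ℝ} {u v p : Pt}
    (hu : ev c u = 0) (hv : ev c v = 0) (hp : p ∈ affineSpan ℝ ({u, v} : Set Pt)) :
    ev c p = 0 := by
  obtain ⟨t, rfl⟩ := mem_affineSpan_pair_iff_exists_lineMap_eq.1 hp
  rw [AffineMap.lineMap_apply_module, ev_comb c (by ring), hu, hv]
  ring

/-- Around a point strictly between two zeros of opposite sign values. -/
theorem exists_ev_eq_zero {c : ℝ × ℝ × ℝ} {u v : Pt} (h : ev c u * ev c v < 0) :
    ∃ w ∈ openSegment ℝ u v, ev c w = 0 := by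
  have hne : ev c u - ev c v ≠ 0 := by
    intro h0
    rw [sub_eq_zero.1 h0] at h
    nlinarith [mul_self_nonneg (ev c v)]
  rcases mul_neg_iff.1 h with ⟨h1, h2⟩ | ⟨h1, h2⟩
  · refine ⟨_, ⟨-ev c v / (ev c u - ev c v), ev c u / (ev c u - ev c v), ?_, ?_, ?_, rfl⟩, ?_⟩
    · apply div_pos <;> linarith
    · apply div_pos <;> linarith
    · field_simp; ring
    · rw [ev_comb _ (by field_simp; ring)]; field_simp; ring
  · refine ⟨_, ⟨-ev c v / (ev c u - ev c v), ev c u / (ev c u - ev c v), ?_, ?_, ?_, rfl⟩, ?_⟩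
    · apply div_pos_of_neg_of_neg <;> linarith
    · apply div_pos_of_neg_of_neg <;> linarith
    · field_simp; ring
    · rw [ev_comb _ (by field_simp; ring)]; field_simp; ring

namespace TBA

variable (Δ : TBA)

/-- Barycentric coordinates of the triangle. -/
theorem exists_bary : ∃ c : Fin 3 → ℝ × ℝ × ℝ,
    (ev (c 0) Δ.x1 = 1 ∧ ev (c 0) Δ.x2 = 0 ∧ ev (c 0) Δ.x3 = 0) ∧
    (ev (c 1) Δ.x1 = 0 ∧ ev (c 1) Δ.x2 = 1 ∧ ev (c 1) Δ.x3 = 0) ∧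
    (ev (c 2) Δ.x1 = 0 ∧ ev (c 2) Δ.x2 = 0 ∧ ev (c 2) Δ.x3 = 1) ∧
    (∀ p, ev (c 0) p + ev (c 1) p + ev (c 2) p = 1) ∧
    (∀ p, ev (c 0) p • Δ.x1 + ev (c 1) p • Δ.x2 + ev (c 2) p • Δ.x3 = p) := by
  have hD : (Δ.x2.1 - Δ.x1.1) * (Δ.x3.2 - Δ.x1.2) - (Δ.x2.2 - Δ.x1.2) * (Δ.x3.1 - Δ.x1.1) ≠ 0 := by
    intro h0
    have hi := Δ.indep
    rw [affineIndependent_iff_not_collinear_set] at hi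
    apply hi
    rw [collinear_iff_of_mem (p₀ := Δ.x1) (by simp)]
    by_cases h12 : Δ.x2 = Δ.x1
    · refine ⟨Δ.x3 - Δ.x1, ?_⟩
      rintro p (rfl | rfl | rfl)
      · exact ⟨0, by simp⟩
      · exact ⟨0, by simp [h12]⟩
      · exact ⟨1, by simp⟩
    · refine ⟨Δ.x2 - Δ.x1, ?_⟩
      rintro p (rfl | rfl | rfl)
      · exact ⟨0, by simp⟩
      · exact ⟨1, by simp⟩
      · have hN : (Δ.x2.1 - Δ.x1.1) ^ 2 + (Δ.x2.2 - Δ.x1.2) ^ 2 ≠ 0 := by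
          intro h
          apply h12
          ext <;> nlinarith [sq_nonneg (Δ.x2.1 - Δ.x1.1), sq_nonneg (Δ.x2.2 - Δ.x1.2)]
        refine ⟨((Δ.x2.1 - Δ.x1.1) * (Δ.x3.1 - Δ.x1.1) + (Δ.x2.2 - Δ.x1.2) * (Δ.x3.2 - Δ.x1.2)) /
          ((Δ.x2.1 - Δ.x1.1) ^ 2 + (Δ.x2.2 - Δ.x1.2) ^ 2), ?_⟩
        ext
        · simp only [vadd_eq_add, Prod.fst_add, Prod.smul_fst, Prod.fst_sub, smul_eq_mul]
          field_simp
          linear_combination (-(Δ.x2.2 - Δ.x1.2)) * h0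
        · simp only [vadd_eq_add, Prod.snd_add, Prod.smul_snd, Prod.snd_sub, smul_eq_mul]
          field_simp
          linear_combination (Δ.x2.1 - Δ.x1.1) * h0
  obtain ⟨D, hDdef⟩ : ∃ D, D = (Δ.x2.1 - Δ.x1.1) * (Δ.x3.2 - Δ.x1.2) -
      (Δ.x2.2 - Δ.x1.2) * (Δ.x3.1 - Δ.x1.1) := ⟨_, rfl⟩
  rw [← hDdef] at hD
  let l : Pt → Pt → ℝ × ℝ × ℝ := fun u v =>
    (-(v.2 - u.2) / D, (v.1 - u.1) / D, ((v.2 - u.2) * u.1 - (v.1 - u.1) * u.2) / D)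
  refine ⟨![l Δ.x2 Δ.x3, l Δ.x3 Δ.x1, l Δ.x1 Δ.x2], ⟨?_, ?_, ?_⟩, ⟨?_, ?_, ?_⟩, ⟨?_, ?_, ?_⟩, ?_, ?_⟩
  all_goals
    simp only [l, ev, Matrix.cons_val_zero, Matrix.cons_val_one, Matrix.cons_val]
  all_goals try intro p
  all_goals try (field_simp; rw [hDdef]; ring1)
  · ext
    · simp only [Prod.fst_add, Prod.smul_fst, smul_eq_mul]
      field_simp; rw [hDdef]; ring
    · simp only [Prod.snd_add, Prod.smul_snd, smul_eq_mul]
      field_simp; rw [hDdef]; ring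

/-- A choice of barycentric coordinates. -/
def bary : Fin 3 → ℝ × ℝ × ℝ := Δ.exists_bary.choose

theorem ev_eq_bary (c : ℝ × ℝ × ℝ) (p : Pt) :
    ev c p = ev (Δ.bary 0) p * ev c Δ.x1 + ev (Δ.bary 1) p * ev c Δ.x2 +
      ev (Δ.bary 2) p * ev c Δ.x3 := by
  obtain ⟨-, -, -, h, h'⟩ := Δ.exists_bary.choose_spec
  have h1 := congrArg Prod.fst (h' p)
  have h2 := congrArg Prod.snd (h' p)
  have h3 := h p
  change ev (Δ.bary 0) p + ev (Δ.bary 1) p + ev (Δ.bary 2) p = 1 at h3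
  change (ev (Δ.bary 0) p • Δ.x1 + ev (Δ.bary 1) p • Δ.x2 + ev (Δ.bary 2) p • Δ.x3).1 = _ at h1
  change (ev (Δ.bary 0) p • Δ.x1 + ev (Δ.bary 1) p • Δ.x2 + ev (Δ.bary 2) p • Δ.x3).2 = _ at h2
  generalize ev (Δ.bary 0) p = a at *
  generalize ev (Δ.bary 1) p = b at *
  generalize ev (Δ.bary 2) p = d at *
  simp only [Prod.fst_add, Prod.snd_add, Prod.smul_fst, Prod.smul_snd, smul_eq_mul] at h1 h2
  simp only [ev]
  linear_combination (-c.1) * h1 - c.2.1 * h2 - c.2.2 * h3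

theorem mem_tri_iff_bary (p : Pt) : p ∈ Δ.tri ↔ ∀ i, 0 ≤ ev (Δ.bary i) p := by
  obtain ⟨⟨a1, a2, a3⟩, ⟨b1, b2, b3⟩, ⟨c1, c2, c3⟩, h, h'⟩ := Δ.exists_bary.choose_spec
  change ev (Δ.bary 0) _ = _ at a1 a2 a3
  change ev (Δ.bary 1) _ = _ at b1 b2 b3
  change ev (Δ.bary 2) _ = _ at c1 c2 c3
  constructor
  · intro hp i
    have hconv : Convex ℝ {q : Pt | 0 ≤ ev (Δ.bary i) q} := by
      intro u hu v hv a b ha hb hab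
      simp only [mem_ofPred_eq] at *
      rw [ev_comb _ hab]
      positivity
    have : Δ.tri ⊆ {q : Pt | 0 ≤ ev (Δ.bary i) q} := by
      refine convexHull_min ?_ hconv
      rintro q (rfl | rfl | rfl) <;> fin_cases i <;> simp [a1, a2, a3, b1, b2, b3, c1, c2, c3]
    exact this hp
  · intro hp
    rw [← h' p]
    change ev (Δ.bary 0) p • Δ.x1 + ev (Δ.bary 1) p • Δ.x2 + ev (Δ.bary 2) p • Δ.x3 ∈ Δ.tri
    have hs : ev (Δ.bary 0) p + ev (Δ.bary 1) p + ev (Δ.bary 2) p = 1 := h p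
    have := (convex_convexHull ℝ ({Δ.x1, Δ.x2, Δ.x3} : Set Pt)).sum_mem (t := Finset.univ)
      (w := fun i => ev (Δ.bary i) p) (z := ![Δ.x1, Δ.x2, Δ.x3]) (fun i _ => hp i)
      (by simpa [Fin.sum_univ_three] using hs)
      (fun i _ => subset_convexHull ℝ _ (by fin_cases i <;> simp))
    simpa [Fin.sum_univ_three, tri] using this

theorem convex_tri : Convex ℝ Δ.tri := convex_convexHull ℝ _

end TBA

/-- The coefficients of the line through two points. -/
def lineCoef (a b : Pt) : ℝ × ℝ × ℝ :=
  (b.2 - a.2, -(b.1 - a.1), -(b.2 - a.2) * a.1 + (b.1 - a.1) * a.2)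

theorem ev_lineCoef_left (a b : Pt) : ev (lineCoef a b) a = 0 := by
  simp only [ev, lineCoef]; ring

theorem ev_lineCoef_right (a b : Pt) : ev (lineCoef a b) b = 0 := by
  simp only [ev, lineCoef]; ring

theorem lineCoef_ne {a b : Pt} (h : a ≠ b) : (lineCoef a b).1 ≠ 0 ∨ (lineCoef a b).2.1 ≠ 0 := by
  by_contra! h'
  apply h
  simp only [lineCoef] at h'
  exact Prod.ext (by linarith [h'.2]) (by linarith [h'.1])

namespace TBA

variable {Δ : TBA}

theorem mem_edge_iff (p : Pt) :
    (p ∈ segment ℝ Δ.x1 Δ.x2 ↔ p ∈ Δ.tri ∧ ev (Δ.bary 2) p = 0) ∧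
    (p ∈ segment ℝ Δ.x2 Δ.x3 ↔ p ∈ Δ.tri ∧ ev (Δ.bary 0) p = 0) ∧
    (p ∈ segment ℝ Δ.x3 Δ.x1 ↔ p ∈ Δ.tri ∧ ev (Δ.bary 1) p = 0) := by
  obtain ⟨⟨a1, a2, a3⟩, ⟨b1, b2, b3⟩, ⟨c1, c2, c3⟩, h, h'⟩ := Δ.exists_bary.choose_spec
  change ev (Δ.bary 0) _ = _ at a1 a2 a3
  change ev (Δ.bary 1) _ = _ at b1 b2 b3
  change ev (Δ.bary 2) _ = _ at c1 c2 c3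
  have hs := h p
  have hp := h' p
  change ev (Δ.bary 0) p + ev (Δ.bary 1) p + ev (Δ.bary 2) p = 1 at hs
  change ev (Δ.bary 0) p • Δ.x1 + ev (Δ.bary 1) p • Δ.x2 + ev (Δ.bary 2) p • Δ.x3 = p at hp
  have hT := Δ.mem_tri_iff_bary p
  have m1 : Δ.x1 ∈ Δ.tri := subset_convexHull ℝ _ (by simp)
  have m2 : Δ.x2 ∈ Δ.tri := subset_convexHull ℝ _ (by simp)
  have m3 : Δ.x3 ∈ Δ.tri := subset_convexHull ℝ _ (by simp)
  refine ⟨⟨?_, ?_⟩, ⟨?_, ?_⟩, ⟨?_, ?_⟩⟩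
  · intro hm
    refine ⟨Δ.convex_tri.segment_subset m1 m2 hm, ?_⟩
    obtain ⟨a, b, -, -, hab, rfl⟩ := hm
    rw [ev_comb _ hab, c1, c2]; ring
  · rintro ⟨hm, h0⟩
    have := hT.1 hm
    refine ⟨_, _, this 0, this 1, by linarith, ?_⟩
    conv_rhs => rw [← hp, h0]
    simp
  · intro hm
    refine ⟨Δ.convex_tri.segment_subset m2 m3 hm, ?_⟩
    obtain ⟨a, b, -, -, hab, rfl⟩ := hm
    rw [ev_comb _ hab, a2, a3]; ring
  · rintro ⟨hm, h0⟩
    have := hT.1 hm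
    refine ⟨_, _, this 1, this 2, by linarith, ?_⟩
    conv_rhs => rw [← hp, h0]
    simp
  · intro hm
    refine ⟨Δ.convex_tri.segment_subset m3 m1 hm, ?_⟩
    obtain ⟨a, b, -, -, hab, rfl⟩ := hm
    rw [ev_comb _ hab, b3, b1]; ring
  · rintro ⟨hm, h0⟩
    have := hT.1 hm
    refine ⟨_, _, this 2, this 0, by linarith, ?_⟩
    conv_rhs => rw [← hp, h0]
    simp [add_comm]

theorem mem_bdry_iff (p : Pt) :
    p ∈ triBdry Δ.x1 Δ.x2 Δ.x3 ↔ p ∈ Δ.tri ∧ ∃ i, ev (Δ.bary i) p = 0 := by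
  obtain ⟨h1, h2, h3⟩ := Δ.mem_edge_iff p
  rw [triBdry, mem_union, mem_union, h1, h2, h3, Fin.exists_fin_succ, Fin.exists_fin_succ,
    Fin.exists_fin_succ]
  simp only [IsEmpty.exists_iff, or_false]
  change _ ↔ _ ∧ (ev (Δ.bary 0) p = 0 ∨ ev (Δ.bary 1) p = 0 ∨ ev (Δ.bary 2) p = 0)
  tauto

theorem le_one_of_bdry {a b : Pt} (ha : a ∈ triBdry Δ.x1 Δ.x2 Δ.x3)
    (hb : b ∈ triBdry Δ.x1 Δ.x2 Δ.x3)
    (hab : ∀ p ∈ openSegment ℝ a b, p ∉ triBdry Δ.x1 Δ.x2 Δ.x3) {t : ℝ}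
    (hp : AffineMap.lineMap a b t ∈ Δ.tri) : t ≤ 1 := by
  by_contra! ht
  rw [mem_bdry_iff] at ha hb
  obtain ⟨hbT, i, hi⟩ := hb
  have h1 := (Δ.mem_tri_iff_bary a).1 ha.1 i
  have h2 := (Δ.mem_tri_iff_bary _).1 hp i
  rw [AffineMap.lineMap_apply_module, ev_comb _ (by ring), hi] at h2
  have h3 : ev (Δ.bary i) a = 0 := by nlinarith
  have hm : ((1 / 2 : ℝ) • a + (1 / 2 : ℝ) • b : Pt) ∈ openSegment ℝ a b :=
    ⟨1 / 2, 1 / 2, by norm_num, by norm_num, by norm_num, rfl⟩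
  refine hab _ hm ((Δ.mem_bdry_iff _).2 ⟨?_, i, ?_⟩)
  · exact Δ.convex_tri.segment_subset ha.1 hbT (openSegment_subset_segment ℝ _ _ hm)
  · rw [ev_comb _ (by norm_num), hi, h3]; ring

theorem bary_ne (i : Fin 3) : (Δ.bary i).1 ≠ 0 ∨ (Δ.bary i).2.1 ≠ 0 := by
  obtain ⟨⟨a1, a2, -⟩, ⟨b1, b2, -⟩, ⟨c1, -, c3⟩, -, -⟩ := Δ.exists_bary.choose_spec
  change ev (Δ.bary 0) _ = _ at a1 a2
  change ev (Δ.bary 1) _ = _ at b1 b2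
  change ev (Δ.bary 2) _ = _ at c1 c3
  by_contra! h
  fin_cases i <;> simp_all [ev]

theorem exists_coef {s : Set Pt} (hs : s ∈ Δ.Sbar ∪ Δ.B) : ∃ c : ℝ × ℝ × ℝ,
    (c.1 ≠ 0 ∨ c.2.1 ≠ 0) ∧ (∀ p, p ∈ s ↔ p ∈ Δ.tri ∧ ev c p = 0) ∧
    (s ∈ triEdges Δ.x1 Δ.x2 Δ.x3 → ∀ p ∈ Δ.tri, 0 ≤ ev c p) := by
  by_cases he : s ∈ triEdges Δ.x1 Δ.x2 Δ.x3
  · have key := Δ.mem_tri_iff_bary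
    rcases he with rfl | rfl | rfl
    · exact ⟨Δ.bary 2, Δ.bary_ne 2, fun p => (Δ.mem_edge_iff p).1, fun _ p hp => (key p).1 hp 2⟩
    · exact ⟨Δ.bary 0, Δ.bary_ne 0, fun p => (Δ.mem_edge_iff p).2.1, fun _ p hp => (key p).1 hp 0⟩
    · exact ⟨Δ.bary 1, Δ.bary_ne 1, fun p => (Δ.mem_edge_iff p).2.2, fun _ p hp => (key p).1 hp 1⟩
  · have hs' : s ∈ Δ.S ∪ Δ.B := by
      rcases hs with (hs | hs) | hs
      · exact Or.inl hs
      · exact absurd hs he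
      · exact Or.inr hs
    obtain ⟨a, b, hne, rfl, ha, hb, hab⟩ := Δ.seg_wf s hs'
    refine ⟨lineCoef a b, lineCoef_ne hne, fun p => ⟨fun hp => ⟨?_, ?_⟩, ?_⟩, fun h => absurd h he⟩
    · exact Δ.convex_tri.segment_subset ((Δ.mem_bdry_iff a).1 ha).1 ((Δ.mem_bdry_iff b).1 hb).1 hp
    · obtain ⟨x, y, -, -, h, rfl⟩ := hp
      rw [ev_comb _ h, ev_lineCoef_left, ev_lineCoef_right]; ring
    · rintro ⟨hT, h0⟩
      obtain ⟨t, rfl⟩ := mem_affineSpan_pair_iff_exists_lineMap_eq.1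
        (mem_affineSpan_of_ev (lineCoef_ne hne) hne (ev_lineCoef_left a b)
          (ev_lineCoef_right a b) h0)
      have h1 := le_one_of_bdry ha hb hab hT
      rw [← AffineMap.lineMap_apply_one_sub] at hT
      have h2 := le_one_of_bdry hb ha (by rwa [openSegment_symm]) hT
      rw [segment_eq_image_lineMap]
      exact ⟨t, ⟨by linarith, h1⟩, rfl⟩

open Classical in
/-- A choice of coefficients of the line carrying a segment of the arrangement. -/
def coef (Δ : TBA) (s : Set Pt) : ℝ × ℝ × ℝ :=
  if h : s ∈ Δ.Sbar ∪ Δ.B then (exists_coef h).choose else 0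

/-- The affine function vanishing on a segment of the arrangement. -/
def side (Δ : TBA) (s : Set Pt) (p : Pt) : ℝ := ev (Δ.coef s) p

theorem coef_spec {s : Set Pt} (hs : s ∈ Δ.Sbar ∪ Δ.B) :
    ((Δ.coef s).1 ≠ 0 ∨ (Δ.coef s).2.1 ≠ 0) ∧ (∀ p, p ∈ s ↔ p ∈ Δ.tri ∧ Δ.side s p = 0) ∧
    (s ∈ triEdges Δ.x1 Δ.x2 Δ.x3 → ∀ p ∈ Δ.tri, 0 ≤ Δ.side s p) := by
  unfold side coef
  rw [dif_pos hs]
  exact (exists_coef hs).choose_spec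

theorem side_comb (s : Set Pt) {a b : ℝ} (h : a + b = 1) (u v : Pt) :
    Δ.side s (a • u + b • v) = a * Δ.side s u + b * Δ.side s v := ev_comb _ h u v

theorem side_openSegment (s : Set Pt) {u v w : Pt} (h : w ∈ openSegment ℝ u v) :
    ∃ a b : ℝ, 0 < a ∧ 0 < b ∧ Δ.side s w = a * Δ.side s u + b * Δ.side s v := by
  obtain ⟨a, b, ha, hb, hab, rfl⟩ := h
  exact ⟨a, b, ha, hb, side_comb s hab u v⟩

theorem mem_tri {s : Set Pt} (hs : s ∈ Δ.Sbar ∪ Δ.B) {p : Pt} (hp : p ∈ s) : p ∈ Δ.tri :=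
  (((coef_spec hs).2.1 p).1 hp).1

theorem side_eq_zero {s : Set Pt} (hs : s ∈ Δ.Sbar ∪ Δ.B) {p : Pt} (hp : p ∈ s) :
    Δ.side s p = 0 :=
  (((coef_spec hs).2.1 p).1 hp).2

theorem mem_of_side_eq_zero {s : Set Pt} (hs : s ∈ Δ.Sbar ∪ Δ.B) {p : Pt} (hp : p ∈ Δ.tri)
    (h : Δ.side s p = 0) : p ∈ s :=
  ((coef_spec hs).2.1 p).2 ⟨hp, h⟩

theorem triEdges_subset : triEdges Δ.x1 Δ.x2 Δ.x3 ⊆ Δ.Sbar := subset_union_right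

theorem S_subset : Δ.S ⊆ Δ.Sbar := subset_union_left

theorem side_edge_nonneg {e : Set Pt} (he : e ∈ triEdges Δ.x1 Δ.x2 Δ.x3) {p : Pt}
    (hp : p ∈ Δ.tri) : 0 ≤ Δ.side e p :=
  (coef_spec (Or.inl (triEdges_subset he))).2.2 he p hp

theorem x1_mem_tri : Δ.x1 ∈ Δ.tri := subset_convexHull ℝ _ (by simp)
theorem x2_mem_tri : Δ.x2 ∈ Δ.tri := subset_convexHull ℝ _ (by simp)
theorem x3_mem_tri : Δ.x3 ∈ Δ.tri := subset_convexHull ℝ _ (by simp)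

/-- No segment of the arrangement contains the three vertices of the triangle. -/
theorem side_vertices_ne {s : Set Pt} (hs : s ∈ Δ.Sbar ∪ Δ.B) (h1 : Δ.side s Δ.x1 = 0)
    (h2 : Δ.side s Δ.x2 = 0) (h3 : Δ.side s Δ.x3 = 0) : False := by
  have h : ∀ p, ev (Δ.coef s) p = 0 := fun p => by
    rw [Δ.ev_eq_bary]
    change Δ.side s Δ.x1 = 0 at h1
    unfold side at h1 h2 h3
    rw [h1, h2, h3]; ring
  have e1 := h (0, 0)
  have e2 := h (1, 0)
  have e3 := h (0, 1)
  simp only [ev] at e1 e2 e3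
  rcases (coef_spec hs).1 with h' | h' <;> apply h' <;> linarith

theorem mem_tri_of_edges {p : Pt} (h : ∀ e ∈ triEdges Δ.x1 Δ.x2 Δ.x3, 0 ≤ Δ.side e p) :
    p ∈ Δ.tri := by
  have key : ∀ e ∈ triEdges Δ.x1 Δ.x2 Δ.x3, Δ.side e p = ev (Δ.bary 0) p * Δ.side e Δ.x1 +
      ev (Δ.bary 1) p * Δ.side e Δ.x2 + ev (Δ.bary 2) p * Δ.side e Δ.x3 :=
    fun e _ => Δ.ev_eq_bary _ p
  have m : ∀ e ∈ triEdges Δ.x1 Δ.x2 Δ.x3, e ∈ Δ.Sbar ∪ Δ.B :=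
    fun e he => Or.inl (triEdges_subset he)
  have e1 : segment ℝ Δ.x1 Δ.x2 ∈ triEdges Δ.x1 Δ.x2 Δ.x3 := by simp [triEdges]
  have e2 : segment ℝ Δ.x2 Δ.x3 ∈ triEdges Δ.x1 Δ.x2 Δ.x3 := by simp [triEdges]
  have e3 : segment ℝ Δ.x3 Δ.x1 ∈ triEdges Δ.x1 Δ.x2 Δ.x3 := by simp [triEdges]
  rw [mem_tri_iff_bary]
  have z12 := side_eq_zero (m _ e1) (left_mem_segment ℝ Δ.x1 Δ.x2)
  have z12' := side_eq_zero (m _ e1) (right_mem_segment ℝ Δ.x1 Δ.x2)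
  have z23 := side_eq_zero (m _ e2) (left_mem_segment ℝ Δ.x2 Δ.x3)
  have z23' := side_eq_zero (m _ e2) (right_mem_segment ℝ Δ.x2 Δ.x3)
  have z31 := side_eq_zero (m _ e3) (left_mem_segment ℝ Δ.x3 Δ.x1)
  have z31' := side_eq_zero (m _ e3) (right_mem_segment ℝ Δ.x3 Δ.x1)
  have p3 := (side_edge_nonneg e1 x3_mem_tri).lt_of_ne
    fun h => side_vertices_ne (m _ e1) z12 z12' h.symm
  have p1 := (side_edge_nonneg e2 x1_mem_tri).lt_of_ne
    fun h => side_vertices_ne (m _ e2) h.symm z23 z23'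
  have p2 := (side_edge_nonneg e3 x2_mem_tri).lt_of_ne
    fun h => side_vertices_ne (m _ e3) z31' h.symm z31
  have k1 := key _ e1
  have k2 := key _ e2
  have k3 := key _ e3
  rw [z12, z12'] at k1
  rw [z23, z23'] at k2
  rw [z31, z31'] at k3
  have h1 := h _ e1
  have h2 := h _ e2
  have h3 := h _ e3
  intro i
  fin_cases i
  · change 0 ≤ ev (Δ.bary 0) p
    exact nonneg_of_mul_nonneg_left (b := Δ.side (segment ℝ Δ.x2 Δ.x3) Δ.x1) (by linarith) p1
  · change 0 ≤ ev (Δ.bary 1) p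
    exact nonneg_of_mul_nonneg_left (b := Δ.side (segment ℝ Δ.x3 Δ.x1) Δ.x2) (by linarith) p2
  · change 0 ≤ ev (Δ.bary 2) p
    exact nonneg_of_mul_nonneg_left (b := Δ.side (segment ℝ Δ.x1 Δ.x2) Δ.x3) (by linarith) p3

/-- Two segments of the arrangement with two common points coincide. -/
theorem eq_of_two {s t : Set Pt} (hs : s ∈ Δ.Sbar ∪ Δ.B) (ht : t ∈ Δ.Sbar ∪ Δ.B) {u v : Pt}
    (huv : u ≠ v) (hus : u ∈ s) (hvs : v ∈ s) (hut : u ∈ t) (hvt : v ∈ t) : s = t := by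
  have key : ∀ {s t : Set Pt}, s ∈ Δ.Sbar ∪ Δ.B → t ∈ Δ.Sbar ∪ Δ.B → u ∈ s → v ∈ s → u ∈ t →
      v ∈ t → s ⊆ t := fun {s t} hs ht hus hvs hut hvt p hp =>
    mem_of_side_eq_zero ht (mem_tri hs hp) <| ev_eq_zero_of_two (coef_spec hs).1 huv
      (side_eq_zero hs hus) (side_eq_zero hs hvs) (side_eq_zero ht hut) (side_eq_zero ht hvt)
      (side_eq_zero hs hp)
  exact (key hs ht hus hvs hut hvt).antisymm (key ht hs hut hvt hus hvs)

theorem exists_cross {s : Set Pt} (hs : s ∈ Δ.Sbar ∪ Δ.B) {u v : Pt} (hu : u ∈ Δ.tri)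
    (hv : v ∈ Δ.tri) (h : Δ.side s u * Δ.side s v < 0) : ∃ w ∈ openSegment ℝ u v, w ∈ s := by
  obtain ⟨w, hw, h0⟩ := exists_ev_eq_zero h
  exact ⟨w, hw, mem_of_side_eq_zero hs
    (Δ.convex_tri.segment_subset hu hv (openSegment_subset_segment ℝ _ _ hw)) h0⟩

theorem mem_of_openSegment {s : Set Pt} (hs : s ∈ Δ.Sbar ∪ Δ.B) {u v w : Pt} (hu : u ∈ s)
    (hv : v ∈ s) (hw : w ∈ openSegment ℝ u v) : w ∈ s := by
  refine mem_of_side_eq_zero hs (Δ.convex_tri.segment_subset (mem_tri hs hu) (mem_tri hs hv)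
    (openSegment_subset_segment ℝ _ _ hw)) ?_
  obtain ⟨a, b, -, -, h⟩ := side_openSegment (Δ := Δ) s hw
  rw [h, side_eq_zero hs hu, side_eq_zero hs hv]; ring

/-- A point of `s` on a segment `t` which separates two points of `s` lies between them. -/
theorem mem_openSegment_of_sep {s t : Set Pt} (hs : s ∈ Δ.Sbar ∪ Δ.B) (ht : t ∈ Δ.Sbar ∪ Δ.B)
    {u v w : Pt} (hu : u ∈ s) (hv : v ∈ s) (hws : w ∈ s) (hwt : w ∈ t)
    (h : Δ.side t u * Δ.side t v < 0) : w ∈ openSegment ℝ u v := by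
  obtain ⟨w', hw', hw't⟩ := exists_cross ht (mem_tri hs hu) (mem_tri hs hv) h
  by_cases hww : w = w'
  · rwa [hww]
  · have := eq_of_two hs ht hww hws (mem_of_openSegment hs hu hv hw') hwt hw't
    rw [← this, side_eq_zero hs hu] at h
    simp at h

theorem conc {r s t : Set Pt} (hr : r ∈ Δ.Sbar) (hs : s ∈ Δ.Sbar) (ht : t ∈ Δ.Sbar)
    (hst : s ≠ t) {v : Pt} (hvr : v ∈ r) (hvs : v ∈ s) (hvt : v ∈ t) : r = s ∨ r = t := by
  by_contra! h
  exact Δ.no_three_concurrent r hr s hs t ht h.1 h.2 hst ⟨v, hvr, hvs, hvt⟩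

theorem exists_segment {s : Set Pt} (hs : s ∈ Δ.Sbar ∪ Δ.B) :
    ∃ a b, a ≠ b ∧ s = segment ℝ a b ∧ a ∈ triBdry Δ.x1 Δ.x2 Δ.x3 ∧
      b ∈ triBdry Δ.x1 Δ.x2 Δ.x3 := by
  have inj := Δ.indep.injective
  have n12 : Δ.x1 ≠ Δ.x2 := inj.ne (show (0 : Fin 3) ≠ 1 by decide)
  have n23 : Δ.x2 ≠ Δ.x3 := inj.ne (show (1 : Fin 3) ≠ 2 by decide)
  have n31 : Δ.x3 ≠ Δ.x1 := inj.ne (show (2 : Fin 3) ≠ 0 by decide)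
  have m1 := left_mem_segment ℝ Δ.x1 Δ.x2
  have m2 := left_mem_segment ℝ Δ.x2 Δ.x3
  have m3 := left_mem_segment ℝ Δ.x3 Δ.x1
  have wf : ∀ s ∈ Δ.S ∪ Δ.B, ∃ a b, a ≠ b ∧ s = segment ℝ a b ∧ a ∈ triBdry Δ.x1 Δ.x2 Δ.x3 ∧
      b ∈ triBdry Δ.x1 Δ.x2 Δ.x3 := fun s hs => by
    obtain ⟨a, b, h1, h2, h3, h4, -⟩ := Δ.seg_wf s hs
    exact ⟨a, b, h1, h2, h3, h4⟩
  rcases hs with (hs | hs) | hs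
  · exact wf s (Or.inl hs)
  · rcases hs with rfl | rfl | rfl
    · exact ⟨_, _, n12, rfl, Or.inl (Or.inl m1), Or.inl (Or.inr m2)⟩
    · exact ⟨_, _, n23, rfl, Or.inl (Or.inr m2), Or.inr m3⟩
    · exact ⟨_, _, n31, rfl, Or.inr m3, Or.inl (Or.inl m1)⟩
  · exact wf s (Or.inr hs)

theorem mem_bdry_edge {p : Pt} (hp : p ∈ triBdry Δ.x1 Δ.x2 Δ.x3) :
    ∃ e ∈ triEdges Δ.x1 Δ.x2 Δ.x3, p ∈ e := by
  rcases hp with (hp | hp) | hp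
  · exact ⟨_, Or.inl rfl, hp⟩
  · exact ⟨_, Or.inr (Or.inl rfl), hp⟩
  · exact ⟨_, Or.inr (Or.inr rfl), hp⟩

theorem finite_Sbar : Δ.Sbar.Finite := by
  refine Δ.finS.union ?_
  unfold triEdges
  exact Set.toFinite _

theorem B_notMem_Sbar {b : Set Pt} (hb : b ∈ Δ.B) : b ∉ Δ.Sbar := by
  intro hs
  have h2 : ∀ p ∈ b, ∃ s' ∈ Δ.Sbar, s' ≠ b ∧ p ∈ s' := fun p hp => by
    obtain ⟨s', h, -⟩ := Δ.second_segment b hs b hb p hp hp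
    exact ⟨s', h⟩
  choose! g hg using h2
  have hinj : InjOn g b := by
    intro p hp q hq hpq
    by_contra hne
    exact (hg p hp).2.1 (eq_of_two (Or.inl (hg p hp).1) (Or.inl hs) hne (hg p hp).2.2
      (hpq ▸ (hg q hq).2.2) hp hq)
  have hfin : b.Finite := Set.Finite.of_finite_image
    (Δ.finite_Sbar.subset (by rintro _ ⟨p, hp, rfl⟩; exact (hg p hp).1)) hinj
  obtain ⟨x, y, hne, rfl, -, -⟩ := exists_segment (Δ := Δ) (Or.inr hb)
  rw [segment_eq_image_lineMap] at hfin
  exact (Set.Icc_infinite (zero_lt_one' ℝ))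
    (Set.Finite.of_finite_image hfin (AffineMap.lineMap_injective ℝ hne).injOn)

theorem sgn_pp {a b c : ℝ} (h : 0 < a * b) (h' : 0 < b * c) : 0 < a * c := by
  have := mul_pos h h'
  exact pos_of_mul_pos_left (b := b * b) (by linarith) (mul_self_nonneg b)

theorem sgn_pn {a b c : ℝ} (h : 0 < a * b) (h' : b * c < 0) : a * c < 0 := by
  have := sgn_pp (c := -c) h (by linarith)
  linarith

theorem sgn_np {a b c : ℝ} (h : a * b < 0) (h' : 0 < b * c) : a * c < 0 := by
  have := sgn_pp (a := -a) (by linarith) h'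
  linarith

theorem sgn_nn {a b c : ℝ} (h : a * b < 0) (h' : b * c < 0) : 0 < a * c := by
  exact sgn_pp (b := -b) (by linarith) (by linarith)

theorem nonneg_trans {a b c : ℝ} (h : 0 ≤ a * b) (hb : b ≠ 0) (h' : 0 ≤ b * c) : 0 ≤ a * c := by
  have := mul_nonneg h h'
  have hb' : 0 < b * b := mul_self_pos.2 hb
  exact nonneg_of_mul_nonneg_left (b := b * b) (by linarith) hb'

theorem swap_pos {a b : ℝ} (h : 0 < a * b) : 0 < b * a := by rwa [mul_comm]
theorem swap_neg {a b : ℝ} (h : a * b < 0) : b * a < 0 := by rwa [mul_comm]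
theorem swap_nonneg {a b : ℝ} (h : 0 ≤ a * b) : 0 ≤ b * a := by rwa [mul_comm]
theorem left_ne_of_neg {a b : ℝ} (h : a * b < 0) : a ≠ 0 := fun h0 => by simp [h0] at h
theorem right_ne_of_neg {a b : ℝ} (h : a * b < 0) : b ≠ 0 := fun h0 => by simp [h0] at h
theorem left_ne_of_pos {a b : ℝ} (h : 0 < a * b) : a ≠ 0 := fun h0 => by simp [h0] at h
theorem right_ne_of_pos {a b : ℝ} (h : 0 < a * b) : b ≠ 0 := fun h0 => by simp [h0] at h

/-- No initial segment separates `u` from `v`. -/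
def Adj (Δ : TBA) (u v : Pt) : Prop := ∀ r ∈ Δ.Sbar, 0 ≤ Δ.side r u * Δ.side r v

theorem Adj.symm {u v : Pt} (h : Δ.Adj u v) : Δ.Adj v u := fun r hr => swap_nonneg (h r hr)

theorem bl {s : Set Pt} (hs : s ∈ Δ.Sbar) : s ∈ Δ.Sbar ∪ Δ.B := Or.inl hs

/-- A line through an inner point of a segment separates its endpoints. -/
theorem sep_of_mem_openSegment {u v q : Pt} {t : Set Pt} (hq : q ∈ openSegment ℝ u v)
    (h0 : Δ.side t q = 0) (hu : Δ.side t u ≠ 0) : Δ.side t u * Δ.side t v < 0 := by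
  obtain ⟨a, b, ha, hb, h⟩ := side_openSegment t hq
  rw [h0] at h
  have h1 : 0 < a * (Δ.side t u * Δ.side t u) := mul_pos ha (mul_self_pos.2 hu)
  have h2 : b * (Δ.side t u * Δ.side t v) < 0 := by linear_combination h1 - Δ.side t u * h
  by_contra! h3
  linarith [mul_nonneg hb.le h3]

/-- Moving from a point of the triangle away from `u`, one stays in the triangle for some time,
unless one leaves through an edge. -/
theorem exists_push {m u : Pt} (hm : m ∈ Δ.tri)
    (h : ∀ e ∈ triEdges Δ.x1 Δ.x2 Δ.x3, Δ.side e m = 0 → Δ.side e u ≤ 0) :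
    ∃ ε : ℝ, 0 < ε ∧ (1 + ε) • m + (-ε) • u ∈ Δ.tri := by
  have hev : ∀ᶠ ε : ℝ in nhdsWithin 0 (Ioi 0), ∀ e ∈ triEdges Δ.x1 Δ.x2 Δ.x3,
      0 ≤ (1 + ε) * Δ.side e m + (-ε) * Δ.side e u := by
    rw [Filter.eventually_all_finite (by unfold triEdges; exact Set.toFinite _)]
    intro e he
    rcases (side_edge_nonneg he hm).eq_or_lt with h0 | h0
    · filter_upwards [self_mem_nhdsWithin] with ε hε
      have := mul_nonneg (le_of_lt hε) (neg_nonneg.2 (h e he h0.symm))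
      rw [← h0]
      linarith
    · have hc : Filter.Tendsto (fun ε : ℝ => (1 + ε) * Δ.side e m + (-ε) * Δ.side e u)
          (nhdsWithin 0 (Ioi 0)) (nhds ((1 + 0) * Δ.side e m + (-0) * Δ.side e u)) :=
        (Continuous.tendsto (by fun_prop) 0).mono_left nhdsWithin_le_nhds
      filter_upwards [hc.eventually (lt_mem_nhds (a := 0) (by linarith))] with ε hε
      exact hε.le
  obtain ⟨ε, hε, hpos⟩ := (hev.and self_mem_nhdsWithin).exists
  refine ⟨ε, hpos, mem_tri_of_edges fun e he => ?_⟩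
  rw [side_comb _ (by ring)]
  exact hε e he

theorem S_notMem_triEdges {s : Set Pt} (hs : s ∈ Δ.S) : s ∉ triEdges Δ.x1 Δ.x2 Δ.x3 := by
  intro he
  obtain ⟨a, b, hne, rfl, ha, hb, hab⟩ := Δ.seg_wf s (Or.inl hs)
  have hm : ((1 / 2 : ℝ) • a + (1 / 2 : ℝ) • b : Pt) ∈ openSegment ℝ a b :=
    ⟨1 / 2, 1 / 2, by norm_num, by norm_num, by norm_num, rfl⟩
  apply hab _ hm
  have hm' := openSegment_subset_segment ℝ _ _ hm
  rcases he with h | h | h <;> rw [h] at hm'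
  · exact Or.inl (Or.inl hm')
  · exact Or.inl (Or.inr hm')
  · exact Or.inr hm'

/-- A proper initial segment has points of the triangle on both sides. -/
theorem exists_opp {s : Set Pt} (hs : s ∈ Δ.S) {y : Pt} (hsy : Δ.side s y ≠ 0) :
    ∃ y' ∈ Δ.tri, Δ.side s y * Δ.side s y' < 0 := by
  obtain ⟨a, b, hne, rfl, ha, hb, hab⟩ := Δ.seg_wf s (Or.inl hs)
  have hs' : segment ℝ a b ∈ Δ.Sbar ∪ Δ.B := bl (S_subset hs)
  have hm : ((1 / 2 : ℝ) • a + (1 / 2 : ℝ) • b : Pt) ∈ openSegment ℝ a b :=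
    ⟨1 / 2, 1 / 2, by norm_num, by norm_num, by norm_num, rfl⟩
  set m : Pt := (1 / 2 : ℝ) • a + (1 / 2 : ℝ) • b
  have hms := openSegment_subset_segment ℝ _ _ hm
  obtain ⟨ε, hε, hT⟩ := exists_push (Δ := Δ) (u := y) (mem_tri hs' hms) fun e he h0 => by
    exfalso
    have hme := mem_of_side_eq_zero (bl (triEdges_subset he)) (mem_tri hs' hms) h0
    apply hab m hm
    rcases he with rfl | rfl | rfl
    · exact Or.inl (Or.inl hme)
    · exact Or.inl (Or.inr hme)
    · exact Or.inr hme
  refine ⟨_, hT, ?_⟩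
  rw [side_comb _ (by ring), side_eq_zero hs' hms]
  have := mul_pos hε (mul_self_pos.2 hsy)
  linarith

/-- A segment through a point `v` of `s` extends to the side of `s` containing a given point
of the triangle. -/
theorem exists_extend {s s' : Set Pt} (hs : s ∈ Δ.Sbar) (hs' : s' ∈ Δ.Sbar) (hne : s ≠ s')
    {v y : Pt} (hvs : v ∈ s) (hvs' : v ∈ s') (hy : y ∈ Δ.tri) (hsy : Δ.side s y ≠ 0) :
    ∃ v' ∈ s', 0 < Δ.side s v' * Δ.side s y := by
  obtain ⟨u, hus', huv⟩ : ∃ u ∈ s', u ≠ v := by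
    obtain ⟨a, b, hab, rfl, -, -⟩ := exists_segment (bl hs')
    by_cases h : a = v
    · exact ⟨b, right_mem_segment ℝ a b, fun h' => hab (h.trans h'.symm)⟩
    · exact ⟨a, left_mem_segment ℝ a b, h⟩
  have hsu : Δ.side s u ≠ 0 := fun h0 => hne <| eq_of_two (bl hs) (bl hs') huv
    (mem_of_side_eq_zero (bl hs) (mem_tri (bl hs') hus') h0) hvs hus' hvs'
  rcases (mul_ne_zero hsu hsy).lt_or_gt with h | h
  · obtain ⟨ε, hε, hT⟩ := exists_push (u := u) (mem_tri (bl hs) hvs) fun e he h0 => by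
      have hve := mem_of_side_eq_zero (bl (triEdges_subset he)) (mem_tri (bl hs) hvs) h0
      rcases conc (triEdges_subset he) hs hs' hne hve hvs hvs' with rfl | rfl
      · have := mul_nonneg (side_edge_nonneg he (mem_tri (bl hs') hus')) (side_edge_nonneg he hy)
        linarith
      · exact (side_eq_zero (bl hs') hus').le
    refine ⟨_, mem_of_side_eq_zero (bl hs') hT ?_, ?_⟩
    · rw [side_comb _ (by ring), side_eq_zero (bl hs') hvs', side_eq_zero (bl hs') hus']; ring
    · rw [side_comb _ (by ring), side_eq_zero (bl hs) hvs]
      have := mul_pos_of_neg_of_neg (neg_lt_zero.2 hε) h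
      linarith
  · exact ⟨u, hus', h⟩

/-- The endpoints of an initial segment are vertices of the arrangement. -/
theorem exists_endpoints {s : Set Pt} (hs : s ∈ Δ.Sbar) : ∃ a b, s = segment ℝ a b ∧
    (∃ r ∈ Δ.Sbar, r ≠ s ∧ a ∈ r) ∧ ∃ r ∈ Δ.Sbar, r ≠ s ∧ b ∈ r := by
  have e1 : segment ℝ Δ.x1 Δ.x2 ∈ triEdges Δ.x1 Δ.x2 Δ.x3 := by simp [triEdges]
  have e2 : segment ℝ Δ.x2 Δ.x3 ∈ triEdges Δ.x1 Δ.x2 Δ.x3 := by simp [triEdges]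
  have e3 : segment ℝ Δ.x3 Δ.x1 ∈ triEdges Δ.x1 Δ.x2 Δ.x3 := by simp [triEdges]
  have n : ∀ s ∈ triEdges Δ.x1 Δ.x2 Δ.x3, Δ.x1 ∈ s → Δ.x2 ∈ s → Δ.x3 ∈ s → False :=
    fun s hs h1 h2 h3 => by
      have hs' := bl (triEdges_subset hs)
      exact side_vertices_ne hs' (side_eq_zero hs' h1) (side_eq_zero hs' h2) (side_eq_zero hs' h3)
  have l1 := left_mem_segment ℝ Δ.x1 Δ.x2
  have l2 := left_mem_segment ℝ Δ.x2 Δ.x3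
  have l3 := left_mem_segment ℝ Δ.x3 Δ.x1
  have r1 := right_mem_segment ℝ Δ.x1 Δ.x2
  have r2 := right_mem_segment ℝ Δ.x2 Δ.x3
  have r3 := right_mem_segment ℝ Δ.x3 Δ.x1
  have n12 : segment ℝ Δ.x1 Δ.x2 ≠ segment ℝ Δ.x2 Δ.x3 := fun h => n _ e1 l1 r1 (h ▸ r2)
  have n23 : segment ℝ Δ.x2 Δ.x3 ≠ segment ℝ Δ.x3 Δ.x1 := fun h => n _ e2 (h ▸ r3) l2 r2
  have n31 : segment ℝ Δ.x3 Δ.x1 ≠ segment ℝ Δ.x1 Δ.x2 := fun h => n _ e3 r3 (h ▸ r1) l3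
  rcases hs with hs | hs
  · obtain ⟨a, b, -, rfl, ha, hb, -⟩ := Δ.seg_wf s (Or.inl hs)
    obtain ⟨e, he, hae⟩ := mem_bdry_edge ha
    obtain ⟨e', he', hbe⟩ := mem_bdry_edge hb
    exact ⟨a, b, rfl, ⟨e, triEdges_subset he, fun h => S_notMem_triEdges hs (h ▸ he), hae⟩,
      ⟨e', triEdges_subset he', fun h => S_notMem_triEdges hs (h ▸ he'), hbe⟩⟩
  · rcases hs with rfl | rfl | rfl
    · exact ⟨_, _, rfl, ⟨_, triEdges_subset e3, n31, r3⟩, ⟨_, triEdges_subset e2, n12.symm, l2⟩⟩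
    · exact ⟨_, _, rfl, ⟨_, triEdges_subset e1, n12, r1⟩, ⟨_, triEdges_subset e3, n23.symm, l3⟩⟩
    · exact ⟨_, _, rfl, ⟨_, triEdges_subset e2, n23, r2⟩, ⟨_, triEdges_subset e1, n31.symm, l1⟩⟩

theorem side_ne_zero {s t : Set Pt} (hs : s ∈ Δ.Sbar) (ht : t ∈ Δ.Sbar) (hst : s ≠ t) {v w : Pt}
    (hvs : v ∈ s) (hvt : v ∈ t) (hws : w ∈ s) (hne : w ≠ v) : Δ.side t w ≠ 0 := fun h0 =>
  hst <| eq_of_two (bl hs) (bl ht) hne hws hvs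
    (mem_of_side_eq_zero (bl ht) (mem_tri (bl hs) hws) h0) hvt

/-- The next vertex on `s`, starting from `v`, in the direction of a given point of `s`. -/
theorem exists_next {s t : Set Pt} (hs : s ∈ Δ.Sbar) (ht : t ∈ Δ.Sbar) (hst : s ≠ t)
    {v v' : Pt} (hvs : v ∈ s) (hvt : v ∈ t) (hv's : v' ∈ s) (hne : v' ≠ v) :
    ∃ w ∈ s, w ≠ v ∧ Δ.Adj v w ∧ 0 < Δ.side t w * Δ.side t v' ∧
      ∃ r ∈ Δ.Sbar, r ≠ s ∧ w ∈ r := by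
  have hv' := side_ne_zero hs ht hst hvs hvt hv's hne
  let W : Set (Set Pt) :=
    {r | r ∈ Δ.Sbar ∧ r ≠ s ∧ ∃ w, w ∈ s ∧ w ∈ r ∧ 0 < Δ.side t w * Δ.side t v'}
  have hW : W.Nonempty := by
    obtain ⟨a, b, hsab, ⟨r, hr, hrs, har⟩, ⟨r', hr', hrs', hbr⟩⟩ := exists_endpoints hs
    have has : a ∈ s := hsab ▸ left_mem_segment ℝ a b
    have hbs : b ∈ s := hsab ▸ right_mem_segment ℝ a b
    by_contra hW
    have ha : Δ.side t a * Δ.side t v' ≤ 0 := by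
      by_contra! h
      exact hW ⟨r, hr, hrs, a, has, har, h⟩
    have hb : Δ.side t b * Δ.side t v' ≤ 0 := by
      by_contra! h
      exact hW ⟨r', hr', hrs', b, hbs, hbr, h⟩
    rw [hsab] at hv's
    obtain ⟨x, y, hx, hy, hxy, rfl⟩ := hv's
    have h1 := mul_self_pos.2 hv'
    have h2 := mul_nonneg hx (neg_nonneg.2 ha)
    have h3 := mul_nonneg hy (neg_nonneg.2 hb)
    have h4 := side_comb (Δ := Δ) t hxy a b
    have h5 := congrArg (· * Δ.side t (x • a + y • b)) h4
    linarith
  have hW' : ∀ r ∈ W, ∃ w, w ∈ s ∧ w ∈ r ∧ 0 < Δ.side t w * Δ.side t v' := fun r hr => hr.2.2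
  choose! g hg using hW'
  obtain ⟨r, hr, hmin⟩ := Set.exists_min_image W (fun r => |Δ.side t (g r)|)
    (Δ.finite_Sbar.subset fun r hr => hr.1) hW
  obtain ⟨hgs, hgr, hgt⟩ := hg r hr
  have hgv : g r ≠ v := fun h => by
    rw [h, side_eq_zero (bl ht) hvt] at hgt; simp at hgt
  refine ⟨g r, hgs, hgv, fun r' hr' => ?_, hgt, r, hr.1, hr.2.1, hgr⟩
  by_contra! hsep
  obtain ⟨q, hq, hqr⟩ := exists_cross (bl hr') (mem_tri (bl hs) hvs) (mem_tri (bl hs) hgs) hsep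
  have hqs := mem_of_openSegment (bl hs) hvs hgs hq
  have hr's : r' ≠ s := fun h => by
    rw [h, side_eq_zero (bl hs) hvs] at hsep; simp at hsep
  obtain ⟨a, b, ha, hb, hab, hqe⟩ := hq
  have hsq : Δ.side t q = b * Δ.side t (g r) := by
    rw [← hqe, side_comb t hab, side_eq_zero (bl ht) hvt]; ring
  have hr'W : r' ∈ W := ⟨hr', hr's, q, hqs, hqr, by
    rw [hsq, mul_assoc]; exact mul_pos hb hgt⟩
  obtain ⟨h1, h2, -⟩ := hg r' hr'W
  have hgq : g r' = q := by
    by_contra h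
    exact hr's (eq_of_two (bl hr') (bl hs) h h2 hqr h1 hqs)
  have := hmin r' hr'W
  simp only [hgq, hsq, abs_mul, abs_of_pos hb] at this
  have h3 : 0 < |Δ.side t (g r)| := abs_pos.2 (left_ne_of_pos hgt)
  nlinarith

/-- A blocking segment does not separate adjacent vertices of an initial segment. -/
theorem Adj.side_B_nonneg {r b : Set Pt} (hr : r ∈ Δ.Sbar) (hb : b ∈ Δ.B) {v w : Pt}
    (hvr : v ∈ r) (hwr : w ∈ r) (h : Δ.Adj v w) : 0 ≤ Δ.side b v * Δ.side b w := by
  by_contra! hsep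
  obtain ⟨q, hq, hqb⟩ := exists_cross (Or.inr hb) (mem_tri (bl hr) hvr) (mem_tri (bl hr) hwr) hsep
  have hqr := mem_of_openSegment (bl hr) hvr hwr hq
  obtain ⟨s', ⟨hs', hne, hqs'⟩, -⟩ := Δ.second_segment r hr b hb q hqr hqb
  have hvq : v ≠ q := fun h => left_ne_of_neg hsep (h ▸ side_eq_zero (Or.inr hb) hqb)
  have h1 := side_ne_zero hr hs' hne.symm hqr hqs' hvr hvq
  have := sep_of_mem_openSegment hq (side_eq_zero (bl hs') hqs') h1
  linarith [h s' hs']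

theorem side_B_ne_zero {s b : Set Pt} (hs : s ∈ Δ.Sbar) (hb : b ∈ Δ.B) {u v : Pt} (hus : u ∈ s)
    (hvs : v ∈ s) (hub : u ∈ b) (hne : v ≠ u) : Δ.side b v ≠ 0 := fun h0 =>
  B_notMem_Sbar hb <| (eq_of_two (bl hs) (Or.inr hb) hne hvs hus
    (mem_of_side_eq_zero (Or.inr hb) (mem_tri (bl hs) hvs) h0) hub) ▸ hs

/-- A blocking segment through a vertex of a triangle does not separate two other
vertices which are adjacent. -/
theorem Adj.side_B_pos {s t r b : Set Pt} (hs : s ∈ Δ.Sbar) (ht : t ∈ Δ.Sbar) (hr : r ∈ Δ.Sbar)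
    (hb : b ∈ Δ.B) {u v w : Pt} (hus : u ∈ s) (hut : u ∈ t) (hvs : v ∈ s) (hvr : v ∈ r)
    (hwt : w ∈ t) (hwr : w ∈ r) (hvu : v ≠ u) (hwu : w ≠ u) (hub : u ∈ b) (h : Δ.Adj v w) :
    0 < Δ.side b v * Δ.side b w :=
  (h.side_B_nonneg hr hb hvr hwr).lt_of_ne
    (mul_ne_zero (side_B_ne_zero hs hb hus hvs hub hvu) (side_B_ne_zero ht hb hut hwt hub hwu)).symm

/-- Adjacency is transitive around a vertex. -/
theorem Adj.pasch {s t : Set Pt} (hs : s ∈ Δ.Sbar) (ht : t ∈ Δ.Sbar) (hst : s ≠ t) {z v w : Pt}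
    (hzs : z ∈ s) (hzt : z ∈ t) (hvs : v ∈ s) (hwt : w ∈ t) (h : Δ.Adj z v) (h' : Δ.Adj z w) :
    Δ.Adj v w := by
  intro r hr
  by_cases hz : Δ.side r z = 0
  · rcases conc hr hs ht hst (mem_of_side_eq_zero (bl hr) (mem_tri (bl hs) hzs) hz) hzs hzt
      with rfl | rfl
    · rw [side_eq_zero (bl hr) hvs]; simp
    · rw [side_eq_zero (bl hr) hwt]; simp
  · exact nonneg_trans (h.symm r hr) hz (h' r hr)

/-- The points strictly on the same side of every initial segment as `o`. -/
def openCell (Δ : TBA) (o : Pt) : Set Pt := {q | ∀ r ∈ Δ.Sbar, 0 < Δ.side r o * Δ.side r q}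

/-- The points weakly on the same side of every initial segment as `o`. -/
def cell (Δ : TBA) (o : Pt) : Set Pt := {q | ∀ r ∈ Δ.Sbar, 0 ≤ Δ.side r o * Δ.side r q}

theorem continuous_side (s : Set Pt) : Continuous (Δ.side s) := continuous_ev _

theorem side_ne_zero_of_notMem {o : Pt} (ho : o ∈ Δ.tri \ ⋃₀ Δ.Sbar) {r : Set Pt}
    (hr : r ∈ Δ.Sbar) : Δ.side r o ≠ 0 := fun h0 =>
  ho.2 ⟨r, hr, mem_of_side_eq_zero (bl hr) ho.1 h0⟩

theorem mem_openCell_self {o : Pt} (ho : o ∈ Δ.tri \ ⋃₀ Δ.Sbar) : o ∈ Δ.openCell o :=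
  fun _ hr => mul_self_pos.2 (side_ne_zero_of_notMem ho hr)

theorem cell_subset_tri {o : Pt} (ho : o ∈ Δ.tri \ ⋃₀ Δ.Sbar) : Δ.cell o ⊆ Δ.tri := by
  intro q hq
  refine mem_tri_of_edges fun e he => ?_
  have h := hq e (triEdges_subset he)
  have h' := (side_edge_nonneg he ho.1).lt_of_ne
    (side_ne_zero_of_notMem ho (triEdges_subset he)).symm
  exact nonneg_of_mul_nonneg_right h h'

theorem openCell_subset_cell (o : Pt) : Δ.openCell o ⊆ Δ.cell o := fun _ hq r hr => (hq r hr).le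

theorem isOpen_openCell (o : Pt) : IsOpen (Δ.openCell o) := by
  have : Δ.openCell o = ⋂ r ∈ Δ.Sbar, {q | 0 < Δ.side r o * Δ.side r q} := by
    ext q; simp [openCell]
  rw [this]
  exact Δ.finite_Sbar.isOpen_biInter fun r _ =>
    isOpen_lt continuous_const (continuous_const.mul (continuous_side r))

theorem isClosed_cell (o : Pt) : IsClosed (Δ.cell o) := by
  have : Δ.cell o = ⋂ r ∈ Δ.Sbar, {q | 0 ≤ Δ.side r o * Δ.side r q} := by
    ext q; simp [cell]
  rw [this]
  exact isClosed_biInter fun r _ =>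
    isClosed_le continuous_const (continuous_const.mul (continuous_side r))

theorem convex_cell (o : Pt) : Convex ℝ (Δ.cell o) := by
  intro u hu v hv a b ha hb hab r hr
  rw [side_comb r hab]
  have h1 := mul_nonneg ha (hu r hr)
  have h2 := mul_nonneg hb (hv r hr)
  linarith

theorem openSegment_subset_openCell {o q : Pt} (ho : o ∈ Δ.tri \ ⋃₀ Δ.Sbar) (hq : q ∈ Δ.cell o) :
    openSegment ℝ q o ⊆ Δ.openCell o := by
  rintro p ⟨a, b, ha, hb, hab, rfl⟩ r hr
  rw [side_comb r hab]
  have h1 := mul_nonneg ha.le (hq r hr)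
  have h2 := mul_pos hb (mem_openCell_self ho r hr)
  linarith

theorem convex_openCell {o : Pt} : Convex ℝ (Δ.openCell o) := by
  intro u hu v hv a b ha hb hab r hr
  rw [side_comb r hab]
  have h1 := hu r hr
  have h2 := hv r hr
  rcases ha.eq_or_lt with rfl | ha
  · obtain rfl : b = 1 := by linarith
    linarith
  · have h3 := mul_pos ha h1
    have h4 := mul_nonneg hb h2.le
    linarith

theorem closure_openCell {o : Pt} (ho : o ∈ Δ.tri \ ⋃₀ Δ.Sbar) :
    closure (Δ.openCell o) = Δ.cell o := by
  refine (closure_minimal (openCell_subset_cell o) (isClosed_cell o)).antisymm fun q hq => ?_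
  exact closure_mono (openSegment_subset_openCell ho hq)
    (segment_subset_closure_openSegment (left_mem_segment ℝ q o))

theorem connectedComponentIn_eq {o : Pt} (ho : o ∈ Δ.tri \ ⋃₀ Δ.Sbar) :
    connectedComponentIn (Δ.tri \ ⋃₀ Δ.Sbar) o = Δ.openCell o := by
  apply Subset.antisymm
  · intro q hq r hr
    have hC : IsPreconnected (connectedComponentIn (Δ.tri \ ⋃₀ Δ.Sbar) o) :=
      isPreconnected_connectedComponentIn
    have hsub := connectedComponentIn_subset (Δ.tri \ ⋃₀ Δ.Sbar) o
    refine hC.subset_left_of_subset_union (u := {q | 0 < Δ.side r o * Δ.side r q})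
      (v := {q | Δ.side r o * Δ.side r q < 0})
      (isOpen_lt continuous_const (continuous_const.mul (continuous_side r)))
      (isOpen_lt (continuous_const.mul (continuous_side r)) continuous_const) ?_ ?_
      ⟨o, mem_connectedComponentIn ho, mem_openCell_self ho r hr⟩ hq
    · rw [Set.disjoint_left]
      intro p h h'
      exact lt_asymm (a := (0 : ℝ)) (b := Δ.side r o * Δ.side r p) h h'
    · intro p hp
      rcases (mul_ne_zero (side_ne_zero_of_notMem ho hr)
        (side_ne_zero_of_notMem (hsub hp) hr)).lt_or_gt with h | h
      · exact Or.inr h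
      · exact Or.inl h
  · refine convex_openCell.isPreconnected.subset_connectedComponentIn (mem_openCell_self ho) ?_
    intro q hq
    refine ⟨cell_subset_tri ho (openCell_subset_cell o hq), ?_⟩
    rintro ⟨r, hr, hqr⟩
    exact right_ne_of_pos (hq r hr) (side_eq_zero (bl hr) hqr)

theorem isMinRegion_cell {o : Pt} (ho : o ∈ Δ.tri \ ⋃₀ Δ.Sbar) : Δ.IsMinRegion (Δ.cell o) :=
  ⟨o, ho, by rw [connectedComponentIn_eq ho, closure_openCell ho]⟩

theorem mem_frontier_cell {o q : Pt} (ho : o ∈ Δ.tri \ ⋃₀ Δ.Sbar) (hq : q ∈ Δ.cell o)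
    {r : Set Pt} (hr : r ∈ Δ.Sbar) (h0 : Δ.side r q = 0) : q ∈ frontier (Δ.cell o) := by
  refine ⟨subset_closure hq, fun hint => ?_⟩
  have hc : Filter.Tendsto (fun ε : ℝ => (1 + ε) • q + (-ε) • o) (nhdsWithin 0 (Ioi 0))
      (nhds ((1 + 0 : ℝ) • q + (-0 : ℝ) • o)) :=
    (Continuous.tendsto (by fun_prop) 0).mono_left nhdsWithin_le_nhds
  have hint' : Δ.cell o ∈ nhds ((1 + 0 : ℝ) • q + (-0 : ℝ) • o) := by
    simpa using mem_interior_iff_mem_nhds.1 hint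
  obtain ⟨ε, hε, hpos⟩ := ((hc.eventually hint').and self_mem_nhdsWithin).exists
  have h1 := hε r hr
  rw [side_comb r (by ring), h0] at h1
  have h2 := mul_pos (show 0 < ε from hpos) (mem_openCell_self ho r hr)
  linarith

/-- Walking along the boundary of a cell, from a vertex to the next one. -/
theorem exists_walk {o v : Pt} (ho : o ∈ Δ.tri \ ⋃₀ Δ.Sbar) {s t : Set Pt} (hs : s ∈ Δ.Sbar)
    (ht : t ∈ Δ.Sbar) (hst : s ≠ t) (hv : v ∈ Δ.cell o) (hvs : v ∈ s) (hvt : v ∈ t) :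
    ∃ w ∈ s, w ≠ v ∧ w ∈ Δ.cell o ∧ Δ.Adj v w ∧ ∃ r ∈ Δ.Sbar, r ≠ s ∧ w ∈ r := by
  obtain ⟨v', hv's, hv't⟩ := exists_extend ht hs hst.symm hvt hvs ho.1
    (side_ne_zero_of_notMem ho ht)
  have hne : v' ≠ v := fun h => left_ne_of_pos hv't (h ▸ side_eq_zero (bl ht) hvt)
  obtain ⟨w, hws, hwv, hadj, hwt, hex⟩ := exists_next hs ht hst hvs hvt hv's hne
  refine ⟨w, hws, hwv, fun r hr => ?_, hadj, hex⟩
  by_cases h0 : Δ.side r v = 0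
  · rcases conc hr hs ht hst (mem_of_side_eq_zero (bl hr) (mem_tri (bl hs) hvs) h0) hvs hvt
      with rfl | rfl
    · rw [side_eq_zero (bl hr) hws]; simp
    · exact (swap_pos (sgn_pp hwt hv't)).le
  · exact nonneg_trans (hv r hr) h0 (hadj r hr)

theorem containsEdgeOf_cell {o v : Pt} (ho : o ∈ Δ.tri \ ⋃₀ Δ.Sbar) {s t : Set Pt}
    (hs : s ∈ Δ.Sbar) (ht : t ∈ Δ.Sbar) (hst : s ≠ t) (hv : v ∈ Δ.cell o) (hvs : v ∈ s)
    (hvt : v ∈ t) : Δ.ContainsEdgeOf s (Δ.cell o) := by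
  obtain ⟨w, hws, hwv, hw, -, -⟩ := exists_walk ho hs ht hst hv hvs hvt
  refine ⟨v, w, hwv.symm, fun q hq => ?_⟩
  have h0 : Δ.side s q = 0 := by
    obtain ⟨a, b, -, -, hab, rfl⟩ := hq
    rw [side_comb s hab, side_eq_zero (bl hs) hvs, side_eq_zero (bl hs) hws]; ring
  have hqc := (convex_cell o).segment_subset hv hw hq
  exact ⟨mem_of_side_eq_zero (bl hs) (cell_subset_tri ho hqc) h0, mem_frontier_cell ho hqc hs h0⟩

theorem isRegionVertex_cell {o v : Pt} (ho : o ∈ Δ.tri \ ⋃₀ Δ.Sbar) {s t : Set Pt}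
    (hs : s ∈ Δ.Sbar) (ht : t ∈ Δ.Sbar) (hst : s ≠ t) (hv : v ∈ Δ.cell o) (hvs : v ∈ s)
    (hvt : v ∈ t) : Δ.IsRegionVertex (Δ.cell o) v :=
  ⟨hv, s, hs, t, ht, hst, hvs, hvt, containsEdgeOf_cell ho hs ht hst hv hvs hvt,
    containsEdgeOf_cell ho ht hs hst.symm hv hvt hvs⟩

theorem consec_cell {o u v : Pt} (ho : o ∈ Δ.tri \ ⋃₀ Δ.Sbar) {s : Set Pt} (hs : s ∈ Δ.Sbar)
    (hu : u ∈ Δ.cell o) (hv : v ∈ Δ.cell o) (huv : u ≠ v) (hus : u ∈ s) (hvs : v ∈ s)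
    (hu' : ∃ r ∈ Δ.Sbar, r ≠ s ∧ u ∈ r) (hv' : ∃ r ∈ Δ.Sbar, r ≠ s ∧ v ∈ r) :
    Δ.Consec (Δ.cell o) u v := by
  obtain ⟨r, hr, hrs, hur⟩ := hu'
  obtain ⟨r', hr', hrs', hvr⟩ := hv'
  refine ⟨huv, isRegionVertex_cell ho hr hs hrs hu hur hus,
    isRegionVertex_cell ho hr' hs hrs' hv hvr hvs, fun q hq => ?_⟩
  refine mem_frontier_cell ho ((convex_cell o).segment_subset hu hv hq) hs ?_
  obtain ⟨a, b, -, -, hab, rfl⟩ := hq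
  rw [side_comb s hab, side_eq_zero (bl hs) hus, side_eq_zero (bl hs) hvs]; ring

theorem comb_same_sign {x y z a b c : ℝ} (ha : 0 < a) (hb : 0 < b) (hc : 0 < c)
    (hxy : 0 ≤ x * y) (hxz : 0 ≤ x * z) (hyz : 0 ≤ y * z) :
    0 ≤ (a * x + b * y + c * z) * x ∧ 0 ≤ (a * x + b * y + c * z) * y ∧
      0 ≤ (a * x + b * y + c * z) * z := by
  have := mul_nonneg ha.le (mul_self_nonneg x)
  have := mul_nonneg hb.le (mul_self_nonneg y)
  have := mul_nonneg hc.le (mul_self_nonneg z)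
  have := mul_nonneg ha.le hxy
  have := mul_nonneg ha.le hxz
  have := mul_nonneg hb.le hxy
  have := mul_nonneg hb.le hyz
  have := mul_nonneg hc.le hxz
  have := mul_nonneg hc.le hyz
  refine ⟨?_, ?_, ?_⟩ <;> linarith

theorem comb_eq_zero {x y z a b c : ℝ} (ha : 0 < a) (hb : 0 < b) (hc : 0 < c)
    (hxy : 0 ≤ x * y) (hxz : 0 ≤ x * z) (hyz : 0 ≤ y * z) (h : a * x + b * y + c * z = 0) :
    x = 0 ∧ y = 0 ∧ z = 0 := by
  have := mul_nonneg ha.le hxy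
  have := mul_nonneg ha.le hxz
  have := mul_nonneg hb.le hxy
  have := mul_nonneg hb.le hyz
  have := mul_nonneg hc.le hxz
  have := mul_nonneg hc.le hyz
  have hx := congrArg (· * x) h
  have hy := congrArg (· * y) h
  have hz := congrArg (· * z) h
  refine ⟨?_, ?_, ?_⟩ <;> by_contra hne
  · have := mul_pos ha (mul_self_pos.2 hne)
    linarith
  · have := mul_pos hb (mul_self_pos.2 hne)
    linarith
  · have := mul_pos hc (mul_self_pos.2 hne)
    linarith

/-- Condition (A) at a vertex `v₃`, whose blocking segment separates the next vertices `v₂` and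
`v₄` on the two initial segments through `v₃`. -/
theorem Strong.concurrent (hΔ : Δ.Strong) {s t s' t' b : Set Pt} (hs : s ∈ Δ.Sbar)
    (ht : t ∈ Δ.Sbar) (hs' : s' ∈ Δ.Sbar) (ht' : t' ∈ Δ.Sbar) (hb : b ∈ Δ.B) (hst : s ≠ t)
    (hss : s' ≠ s) (htt : t' ≠ t) {v₂ v₃ v₄ : Pt} (h3s : v₃ ∈ s) (h3t : v₃ ∈ t) (h3b : v₃ ∈ b)
    (h2s : v₂ ∈ s) (h2s' : v₂ ∈ s') (h4t : v₄ ∈ t) (h4t' : v₄ ∈ t') (n23 : v₂ ≠ v₃)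
    (n43 : v₄ ≠ v₃) (a23 : Δ.Adj v₃ v₂) (a43 : Δ.Adj v₃ v₄)
    (hsep : Δ.side b v₂ * Δ.side b v₄ < 0) : s' ≠ t' ∧ ∀ q ∈ s', q ∈ b → q ∈ t' := by
  have a24 : Δ.Adj v₂ v₄ := Adj.pasch hs ht hst h3s h3t h2s h4t a23 a43
  have hst' : s' ≠ t' := by
    rintro rfl
    linarith [a24.side_B_nonneg hs' hb h2s' h4t']
  refine ⟨hst', fun q hqs' hqb => ?_⟩
  have h2T := mem_tri (bl hs) h2s
  have h3T := mem_tri (bl hs) h3s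
  have h4T := mem_tri (bl ht) h4t
  have hbl : b ∈ Δ.Sbar ∪ Δ.B := Or.inr hb
  obtain ⟨q₀, hq₀, hq₀b⟩ := exists_cross hbl h2T h4T hsep
  obtain ⟨α, β, hα, hβ, hαβ, rfl⟩ := hq₀
  set o : Pt := (1 / 2 : ℝ) • v₃ + (1 / 2 : ℝ) • (α • v₂ + β • v₄) with ho_def
  have hob : o ∈ b := mem_of_openSegment hbl h3b hq₀b
    ⟨1 / 2, 1 / 2, by norm_num, by norm_num, by norm_num, rfl⟩
  have hside : ∀ r, Δ.side r o =
      1 / 2 * Δ.side r v₃ + (1 / 2 * α) * Δ.side r v₂ + (1 / 2 * β) * Δ.side r v₄ := fun r => by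
    rw [ho_def, side_comb r (by norm_num), side_comb r hαβ]; ring
  have hα' : 0 < 1 / 2 * α := by positivity
  have hβ' : 0 < 1 / 2 * β := by positivity
  have ho : o ∈ Δ.tri \ ⋃₀ Δ.Sbar := by
    refine ⟨mem_tri hbl hob, ?_⟩
    rintro ⟨r, hr, hor⟩
    have h0 := side_eq_zero (bl hr) hor
    rw [hside] at h0
    obtain ⟨z3, z2, z4⟩ := comb_eq_zero one_half_pos hα' hβ' (a23 r hr) (a43 r hr) (a24 r hr) h0
    have m3 := mem_of_side_eq_zero (bl hr) h3T z3
    have h1 := eq_of_two (bl hr) (bl hs) n23 (mem_of_side_eq_zero (bl hr) h2T z2) m3 h2s h3s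
    have h2 := eq_of_two (bl hr) (bl ht) n43 (mem_of_side_eq_zero (bl hr) h4T z4) m3 h4t h3t
    exact hst (h1.symm.trans h2)
  have hc : ∀ r ∈ Δ.Sbar, _ := fun r hr =>
    comb_same_sign one_half_pos hα' hβ' (a23 r hr) (a43 r hr) (a24 r hr)
  simp only [← hside] at hc
  have c3 : v₃ ∈ Δ.cell o := fun r hr => (hc r hr).1
  have c2 : v₂ ∈ Δ.cell o := fun r hr => (hc r hr).2.1
  have c4 : v₄ ∈ Δ.cell o := fun r hr => (hc r hr).2.2
  obtain ⟨v₁, h1s', n12, c1, a21, r₁, hr₁, hr₁s', h1r⟩ := exists_walk ho hs' hs hss c2 h2s' h2s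
  obtain ⟨v₅, h5t', n54, c5, a45, r₅, hr₅, hr₅t', h5r⟩ := exists_walk ho ht' ht htt c4 h4t' h4t
  have n24 : v₂ ≠ v₄ := by
    rintro rfl
    linarith [mul_self_nonneg (Δ.side b v₂)]
  have h2t : v₂ ∉ t := fun h => hst (eq_of_two (bl hs) (bl ht) n23 h2s h3s h h3t)
  have h4s : v₄ ∉ s := fun h => hst (eq_of_two (bl hs) (bl ht) n43 h h3s h4t h3t)
  have n13 : v₁ ≠ v₃ := by
    rintro rfl
    rcases conc hs' hs ht hst h1s' h3s h3t with h | h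
    · exact hss h
    · exact h2t (h ▸ h2s')
  have n53 : v₅ ≠ v₃ := by
    rintro rfl
    rcases conc ht' hs ht hst h5t' h3s h3t with h | h
    · exact h4s (h ▸ h4t')
    · exact htt h
  have n14 : v₁ ≠ v₄ := by
    rintro rfl
    rcases conc hs' ht' ht htt h1s' h4t' h4t with h | h
    · exact hst' h
    · exact h2t (h ▸ h2s')
  have n25 : v₂ ≠ v₅ := by
    rintro rfl
    rcases conc ht' hs' hs hss h5t' h2s' h2s with h | h
    · exact hst' h.symm
    · exact h4s (h ▸ h4t')
  by_cases n15 : v₁ = v₅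
  · subst n15
    by_cases h1b : v₁ ∈ b
    · by_cases hq : q = v₁
      · rwa [hq]
      · exact absurd (eq_of_two (bl hs') hbl hq hqs' h1s' hqb h1b ▸ hs') (B_notMem_Sbar hb)
    · have h0 : Δ.side b v₁ ≠ 0 := fun h =>
        h1b (mem_of_side_eq_zero hbl (mem_tri (bl hs') h1s') h)
      have := nonneg_trans (a21.side_B_nonneg hs' hb h2s' h1s') h0
        (swap_nonneg (a45.side_B_nonneg ht' hb h4t' h5t'))
      linarith
  · obtain ⟨q', hq'b, hq's', hq't'⟩ := hΔ (Δ.cell o) (isMinRegion_cell ho) v₁ v₂ v₃ v₄ v₅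
      (by simp [n12, n13, n14, n15, n23, n24, n25, n43.symm, n53.symm, n54.symm])
      (consec_cell ho hs' c1 c2 n12 h1s' h2s' ⟨r₁, hr₁, hr₁s', h1r⟩ ⟨s, hs, hss.symm, h2s⟩)
      (consec_cell ho hs c2 c3 n23 h2s h3s ⟨s', hs', hss, h2s'⟩ ⟨t, ht, hst.symm, h3t⟩)
      (consec_cell ho ht c3 c4 n43.symm h3t h4t ⟨s, hs, hst, h3s⟩ ⟨t', ht', htt, h4t'⟩)
      (consec_cell ho ht' c4 c5 n54.symm h4t' h5t' ⟨t, ht, htt.symm, h4t⟩ ⟨r₅, hr₅, hr₅t', h5r⟩)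
      b hb h3b
      ⟨o, hob, interior_maximal (openCell_subset_cell o) (isOpen_openCell o)
        (mem_openCell_self ho)⟩
      ⟨q, mem_tri hbl hqb, mem_affineSpan_of_ev (coef_spec (bl hs')).1 n12
        (side_eq_zero (bl hs') h1s') (side_eq_zero (bl hs') h2s') (side_eq_zero (bl hs') hqs'), hqb⟩
    have hq'T := mem_tri hbl hq'b
    have m1 : q' ∈ s' := mem_of_side_eq_zero (bl hs') hq'T
      (ev_of_mem_affineSpan (side_eq_zero (bl hs') h1s') (side_eq_zero (bl hs') h2s') hq's')
    have m2 : q' ∈ t' := mem_of_side_eq_zero (bl ht') hq'T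
      (ev_of_mem_affineSpan (side_eq_zero (bl ht') h4t') (side_eq_zero (bl ht') h5t') hq't')
    by_cases hq : q = q'
    · rwa [hq]
    · exact absurd (eq_of_two (bl hs') hbl hq hqs' m1 hqb hq'b ▸ hs') (B_notMem_Sbar hb)

theorem eq_of_mem_inter {s t : Set Pt} (hs : s ∈ Δ.Sbar) (ht : t ∈ Δ.Sbar) (hst : s ≠ t)
    {u v : Pt} (hus : u ∈ s) (hut : u ∈ t) (hvs : v ∈ s) (hvt : v ∈ t) : u = v := by
  by_contra h
  exact hst (eq_of_two (bl hs) (bl ht) h hus hvs hut hvt)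

theorem notMem_triEdges_of_sep {h : Set Pt} {u v : Pt} (hu : u ∈ Δ.tri) (hv : v ∈ Δ.tri)
    (hsep : Δ.side h u * Δ.side h v < 0) : h ∉ triEdges Δ.x1 Δ.x2 Δ.x3 := fun he => by
  linarith [mul_nonneg (side_edge_nonneg he hu) (side_edge_nonneg he hv)]

theorem mem_S_of_notMem {s : Set Pt} (hs : s ∈ Δ.Sbar) (h : s ∉ triEdges Δ.x1 Δ.x2 Δ.x3) :
    s ∈ Δ.S := hs.resolve_right h

theorem exists_block {s t : Set Pt} (hs : s ∈ Δ.S) (ht : t ∈ Δ.Sbar) (hst : s ≠ t) {v : Pt}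
    (hvs : v ∈ s) (hvt : v ∈ t) : ∃ b ∈ Δ.B, v ∈ b := by
  obtain ⟨b, ⟨hb, hv⟩, -⟩ := Δ.block_exists s (S_subset hs) t ht hst
    (fun h => S_notMem_triEdges hs h.1) v hvs hvt
  exact ⟨b, hb, hv⟩

/-- A triangular face `A r₁ q₁` and a quadrangular face `r₁ r₂ q₂ q₁` behind it, between two
initial segments `E` and `s` through `A`. -/
structure Ladder (Δ : TBA) (E s h₁ h₂ : Set Pt) (A r₁ r₂ q₁ q₂ : Pt) : Prop where
  hE : E ∈ Δ.Sbar
  hs : s ∈ Δ.Sbar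
  hh₁ : h₁ ∈ Δ.Sbar
  hh₂ : h₂ ∈ Δ.Sbar
  hEs : E ≠ s
  hAE : A ∈ E
  hAs : A ∈ s
  hr₁E : r₁ ∈ E
  hr₂E : r₂ ∈ E
  hq₁s : q₁ ∈ s
  hq₂s : q₂ ∈ s
  hr₁h : r₁ ∈ h₁
  hq₁h : q₁ ∈ h₁
  hr₂h : r₂ ∈ h₂
  hq₂h : q₂ ∈ h₂
  sepr : Δ.side h₁ A * Δ.side h₁ r₂ < 0
  sepq : Δ.side h₁ A * Δ.side h₁ q₂ < 0
  aAr : Δ.Adj A r₁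
  aAq : Δ.Adj A q₁
  arq : Δ.Adj r₁ q₁
  arr : Δ.Adj r₁ r₂
  aqq : Δ.Adj q₁ q₂
  arq' : Δ.Adj r₂ q₂

namespace Ladder

variable {E s h₁ h₂ : Set Pt} {A r₁ r₂ q₁ q₂ : Pt}

theorem symm (L : Δ.Ladder E s h₁ h₂ A r₁ r₂ q₁ q₂) : Δ.Ladder s E h₁ h₂ A q₁ q₂ r₁ r₂ :=
  ⟨L.hs, L.hE, L.hh₁, L.hh₂, L.hEs.symm, L.hAs, L.hAE, L.hq₁s, L.hq₂s, L.hr₁E, L.hr₂E, L.hq₁h,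
    L.hr₁h, L.hq₂h, L.hr₂h, L.sepq, L.sepr, L.aAq, L.aAr, L.arq.symm, L.aqq, L.arr, L.arq'.symm⟩

variable (L : Δ.Ladder E s h₁ h₂ A r₁ r₂ q₁ q₂)
include L

theorem A_notMem : A ∉ h₁ := fun h => left_ne_of_neg L.sepr (side_eq_zero (bl L.hh₁) h)
theorem h₁_ne_E : h₁ ≠ E := fun h => L.A_notMem (h ▸ L.hAE)
theorem h₁_ne_s : h₁ ≠ s := fun h => L.A_notMem (h ▸ L.hAs)
theorem h₁_ne_h₂ : h₁ ≠ h₂ := fun h =>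
  right_ne_of_neg L.sepr (side_eq_zero (bl L.hh₁) (h ▸ L.hr₂h))
theorem h₂_ne_E : h₂ ≠ E := fun h => by
  have h1 := L.sepq
  rw [eq_of_mem_inter L.hE L.hs L.hEs (h ▸ L.hq₂h) L.hq₂s L.hAE L.hAs] at h1
  linarith [mul_self_nonneg (Δ.side h₁ A)]
theorem h₂_ne_s : h₂ ≠ s := L.symm.h₂_ne_E
theorem h₁_mem_S : h₁ ∈ Δ.S := mem_S_of_notMem L.hh₁ <|
  notMem_triEdges_of_sep (mem_tri (bl L.hE) L.hAE) (mem_tri (bl L.hE) L.hr₂E) L.sepr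
theorem r₁_ne_A : r₁ ≠ A := fun h => L.A_notMem (h ▸ L.hr₁h)
theorem q₁_ne_A : q₁ ≠ A := L.symm.r₁_ne_A
theorem r₁_ne_q₁ : r₁ ≠ q₁ := fun h =>
  L.r₁_ne_A (eq_of_mem_inter L.hE L.hs L.hEs L.hr₁E (h ▸ L.hq₁s) L.hAE L.hAs)

/-- The blocking segment through `r₁` is the diagonal `r₁ q₂` of the quadrangular face. -/
theorem exists_diagonal : ∃ b ∈ Δ.B, r₁ ∈ b ∧ q₂ ∈ b := by
  obtain ⟨b, hb, hrb⟩ := exists_block L.h₁_mem_S L.hE L.h₁_ne_E L.hr₁h L.hr₁E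
  refine ⟨b, hb, hrb, ?_⟩
  by_contra hq
  have hq0 : Δ.side b q₂ ≠ 0 := fun h =>
    hq (mem_of_side_eq_zero (Or.inr hb) (mem_tri (bl L.hs) L.hq₂s) h)
  have h1 : 0 < Δ.side b A * Δ.side b q₁ := L.aAq.side_B_pos L.hE L.hh₁ L.hs hb L.hr₁E L.hr₁h
    L.hAE L.hAs L.hq₁h L.hq₁s L.r₁_ne_A.symm L.r₁_ne_q₁.symm hrb
  have h2 : Δ.side b A * Δ.side b r₂ < 0 := sep_of_mem_openSegment
    (mem_openSegment_of_sep (bl L.hE) (bl L.hh₁) L.hAE L.hr₂E L.hr₁E L.hr₁h L.sepr)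
    (side_eq_zero (Or.inr hb) hrb) (left_ne_of_pos h1)
  have h3 := nonneg_trans (L.aqq.side_B_nonneg L.hs hb L.hq₁s L.hq₂s) hq0
    (L.arq'.symm.side_B_nonneg L.hh₂ hb L.hq₂h L.hr₂h)
  linarith [sgn_np (swap_neg h2) h1, mul_comm (Δ.side b r₂) (Δ.side b q₁)]

/-- If `E` extends beyond `A`, then the two rungs of the ladder meet behind `s`. -/
theorem exists_inter (hΔ : Δ.Strong) {A' : Pt} (hA' : A' ∈ E)
    (hsep : Δ.side s A' * Δ.side s r₁ < 0) :
    ∃ v ∈ h₁, v ∈ h₂ ∧ Δ.Adj q₁ v ∧ Δ.side s v * Δ.side s r₁ < 0 := by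
  obtain ⟨b, hb, hqb, hrb⟩ := L.symm.exists_diagonal
  obtain ⟨v', hv'h, hv'⟩ := exists_extend L.hs L.hh₁ L.h₁_ne_s.symm L.hq₁s L.hq₁h
    (mem_tri (bl L.hE) hA') (left_ne_of_neg hsep)
  have hne : v' ≠ q₁ := fun h => left_ne_of_pos hv' (h ▸ side_eq_zero (bl L.hs) L.hq₁s)
  obtain ⟨v, hvh, hvq, hadj, hv, s', hs', hs'h, hvs'⟩ :=
    exists_next L.hh₁ L.hs L.h₁_ne_s L.hq₁h L.hq₁s hv'h hne
  have hvr : Δ.side s v * Δ.side s r₁ < 0 := sgn_pn hv (sgn_pn hv' hsep)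
  have h1 : 0 < Δ.side b A * Δ.side b r₁ := L.aAr.side_B_pos L.hs L.hh₁ L.hE hb L.hq₁s L.hq₁h
    L.hAs L.hAE L.hr₁h L.hr₁E L.q₁_ne_A.symm L.r₁_ne_q₁ hqb
  have h2 : Δ.side b r₁ * Δ.side b v < 0 := sep_of_mem_openSegment
    (mem_openSegment_of_sep (bl L.hh₁) (bl L.hs) L.hr₁h hvh L.hq₁h L.hq₁s (swap_neg hvr))
    (side_eq_zero (Or.inr hb) hqb) (right_ne_of_pos h1)
  obtain ⟨hEs', hcon⟩ := hΔ.concurrent L.hs L.hh₁ L.hE hs' hb L.h₁_ne_s.symm L.hEs hs'h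
    L.hq₁s L.hq₁h hqb L.hAs L.hAE hvh hvs' L.q₁_ne_A.symm hvq L.aAq.symm hadj (sgn_pn h1 h2)
  have hrs' := hcon r₂ L.hr₂E hrb
  rcases conc hs' L.hE L.hh₂ L.h₂_ne_E.symm hrs' L.hr₂E L.hr₂h with h | h
  · exact absurd h.symm hEs'
  · exact ⟨v, hvh, h ▸ hvs', hadj, hvr⟩

/-- There is no ladder with `E` extending beyond `A` and `s` extending beyond `q₂`. -/
theorem false_of_extend_far (hΔ : Δ.Strong) {A' y : Pt} (hA' : A' ∈ E)
    (hsep : Δ.side s A' * Δ.side s r₁ < 0) (hy : y ∈ s)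
    (hysep : Δ.side h₂ y * Δ.side h₂ q₁ < 0) : False := by
  obtain ⟨v, hvh₁, hvh₂, hadj, hvr⟩ := L.exists_inter hΔ hA' hsep
  obtain ⟨b, hb, hrb, hqb⟩ := L.exists_diagonal
  have hq₂v : Δ.Adj q₂ v := Adj.pasch L.hs L.hh₁ L.h₁_ne_s.symm L.hq₁s L.hq₁h L.hq₂s hvh₁
    L.aqq hadj
  have hyq : y ≠ q₂ := fun h => left_ne_of_neg hysep (h ▸ side_eq_zero (bl L.hh₂) L.hq₂h)
  obtain ⟨q₃, hq₃s, hq₃q, hadj', hq₃, s', hs', hs's, hq₃s'⟩ :=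
    exists_next L.hs L.hh₂ L.h₂_ne_s.symm L.hq₂s L.hq₂h hy hyq
  have hq₃sep := sgn_pn hq₃ hysep
  have hq₁b : Δ.side b q₁ ≠ 0 := side_B_ne_zero L.hh₁ hb L.hr₁h L.hq₁h hrb L.r₁_ne_q₁.symm
  have h1 : 0 < Δ.side b v * Δ.side b q₁ := by
    obtain ⟨α, β, hα, hβ, h⟩ := side_openSegment (Δ := Δ) b
      (mem_openSegment_of_sep (bl L.hh₁) (bl L.hs) hvh₁ L.hr₁h L.hq₁h L.hq₁s hvr)
    rw [side_eq_zero (Or.inr hb) hrb] at h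
    have h2 := mul_self_pos.2 hq₁b
    have h3 : 0 < α * (Δ.side b v * Δ.side b q₁) := by
      have := congrArg (· * Δ.side b q₁) h
      linarith
    exact pos_of_mul_pos_right h3 hα.le
  have h2 : Δ.side b q₁ * Δ.side b q₃ < 0 := sep_of_mem_openSegment
    (mem_openSegment_of_sep (bl L.hs) (bl L.hh₂) L.hq₁s hq₃s L.hq₂s L.hq₂h (swap_neg hq₃sep))
    (side_eq_zero (Or.inr hb) hqb) hq₁b
  have hvq₂ : v ≠ q₂ := by
    rintro rfl
    exact right_ne_of_neg L.sepq (side_eq_zero (bl L.hh₁) hvh₁)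
  obtain ⟨hh₁s', hcon⟩ := hΔ.concurrent L.hh₂ L.hs L.hh₁ hs' hb L.h₂_ne_s L.h₁_ne_h₂ hs's
    L.hq₂h L.hq₂s hqb hvh₂ hvh₁ hq₃s hq₃s' hvq₂ hq₃q hq₂v hadj' (sgn_pn h1 h2)
  have hrs' := hcon r₁ L.hr₁h hrb
  rcases conc hs' L.hE L.hh₁ L.h₁_ne_E.symm hrs' L.hr₁E L.hr₁h with h | h
  · have := L.aAq h₂ L.hh₂
    rw [eq_of_mem_inter L.hE L.hs L.hEs (h ▸ hq₃s') hq₃s L.hAE L.hAs] at hq₃sep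
    linarith
  · exact hh₁s' h.symm

/-- There is no ladder with both `E` and `s` extending beyond `A`. -/
theorem false_of_extend_both (hΔ : Δ.Strong) {A' A'' : Pt} (hA' : A' ∈ E)
    (hsep : Δ.side s A' * Δ.side s r₁ < 0) (hA'' : A'' ∈ s)
    (hsep' : Δ.side E A'' * Δ.side E q₁ < 0) : False := by
  obtain ⟨v, hv₁, hv₂, -, h1⟩ := L.exists_inter hΔ hA' hsep
  obtain ⟨v', hv'₁, hv'₂, -, h2⟩ := L.symm.exists_inter hΔ hA'' hsep'
  obtain rfl := eq_of_mem_inter L.hh₁ L.hh₂ L.h₁_ne_h₂ hv₁ hv₂ hv'₁ hv'₂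
  obtain ⟨α, β, hα, hβ, h⟩ := side_openSegment (Δ := Δ) E
    (mem_openSegment_of_sep (bl L.hh₁) (bl L.hs) hv₁ L.hr₁h L.hq₁h L.hq₁s h1)
  rw [side_eq_zero (bl L.hE) L.hr₁E] at h
  have h3 := mul_nonneg hα.le (mul_self_nonneg (Δ.side E v))
  rw [h] at h2
  linarith

end Ladder

/-- The segment `r` cuts the vertex `X` off from the vertices `Y` and `Z`. -/
def Cut (Δ : TBA) (r : Set Pt) (X Y Z : Pt) : Prop :=
  Δ.side r X * Δ.side r Y < 0 ∧ Δ.side r X * Δ.side r Z < 0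

theorem Cut.pos {r : Set Pt} {X Y Z : Pt} (h : Δ.Cut r X Y Z) : 0 < Δ.side r Y * Δ.side r Z :=
  sgn_nn (swap_neg h.1) h.2

theorem Cut.swap {r : Set Pt} {X Y Z : Pt} (h : Δ.Cut r X Y Z) : Δ.Cut r X Z Y := ⟨h.2, h.1⟩

/-- Convex combinations of `A`, `B`, `C`, as seen by the side functions. -/
def InHull (Δ : TBA) (A B C p : Pt) : Prop :=
  ∃ a b c : ℝ, 0 ≤ a ∧ 0 ≤ b ∧ 0 ≤ c ∧ a + b + c = 1 ∧
    ∀ r, Δ.side r p = a * Δ.side r A + b * Δ.side r B + c * Δ.side r C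

theorem inHull_left (A B C : Pt) : Δ.InHull A B C A :=
  ⟨1, 0, 0, by norm_num, le_rfl, le_rfl, by norm_num, fun r => by ring⟩

theorem InHull.symm {A B C p : Pt} (h : Δ.InHull A B C p) : Δ.InHull C B A p := by
  obtain ⟨a, b, c, ha, hb, hc, h1, h⟩ := h
  exact ⟨c, b, a, hc, hb, ha, by linarith, fun r => by rw [h]; ring⟩

theorem InHull.rotate {A B C p : Pt} (h : Δ.InHull A B C p) : Δ.InHull B C A p := by
  obtain ⟨a, b, c, ha, hb, hc, h1, h⟩ := h
  exact ⟨b, c, a, hb, hc, ha, by linarith, fun r => by rw [h]; ring⟩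

theorem inHull_mid (A B C : Pt) : Δ.InHull A B C B := (inHull_left B C A).rotate.rotate

theorem inHull_right (A B C : Pt) : Δ.InHull A B C C := (inHull_left C A B).rotate

theorem InHull.of_openSegment {A B C u v w : Pt} (hu : Δ.InHull A B C u) (hv : Δ.InHull A B C v)
    (hw : w ∈ openSegment ℝ u v) : Δ.InHull A B C w := by
  obtain ⟨a, b, c, ha, hb, hc, h1, h⟩ := hu
  obtain ⟨a', b', c', ha', hb', hc', h1', h'⟩ := hv
  obtain ⟨α, β, hα, hβ, hαβ, rfl⟩ := hw
  refine ⟨α * a + β * a', α * b + β * b', α * c + β * c', by positivity, by positivity,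
    by positivity, ?_, fun r => ?_⟩
  · linear_combination α * h1 + β * h1' + hαβ
  · rw [side_comb r hαβ, h, h']; ring

theorem InHull.nonneg {A B C p : Pt} (h : Δ.InHull A B C p) {r : Set Pt} {k : ℝ}
    (hA : 0 ≤ k * Δ.side r A) (hB : 0 ≤ k * Δ.side r B) (hC : 0 ≤ k * Δ.side r C) :
    0 ≤ k * Δ.side r p := by
  obtain ⟨a, b, c, ha, hb, hc, h1, h⟩ := h
  rw [h]
  have := mul_nonneg ha hA
  have := mul_nonneg hb hB
  have := mul_nonneg hc hC
  linarith

theorem InHull.pos {A B C p : Pt} (h : Δ.InHull A B C p) {r : Set Pt} {k : ℝ}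
    (hA : 0 < k * Δ.side r A) (hB : 0 < k * Δ.side r B) (hC : 0 < k * Δ.side r C) :
    0 < k * Δ.side r p := by
  obtain ⟨a, b, c, ha, hb, hc, h1, h⟩ := h
  rw [h]
  have h3 := mul_nonneg hb hB.le
  have h4 := mul_nonneg hc hC.le
  have h2 := mul_nonneg ha hA.le
  rcases ha.eq_or_lt with rfl | ha
  · rcases hb.eq_or_lt with rfl | hb
    · obtain rfl : c = 1 := by linarith
      linarith
    · have := mul_pos hb hB
      linarith
  · have := mul_pos ha hA
    linarith

/-- On an edge of the hull, positivity at both ends suffices. -/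
theorem InHull.pos_of_edge {A B C p : Pt} (h : Δ.InHull A B C p) {r t : Set Pt} {k : ℝ}
    (hA : Δ.side t A = 0) (hB : Δ.side t B = 0) (hC : Δ.side t C ≠ 0) (hp : Δ.side t p = 0)
    (hA' : 0 < k * Δ.side r A) (hB' : 0 < k * Δ.side r B) : 0 < k * Δ.side r p := by
  obtain ⟨a, b, c, ha, hb, hc, h1, h⟩ := h
  have hc0 : c = 0 := by
    have := h t
    rw [hp, hA, hB] at this
    have h2 : c * Δ.side t C = 0 := by linarith
    exact (mul_eq_zero.1 h2).resolve_right hC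
  subst hc0
  rw [h]
  rcases ha.eq_or_lt with rfl | ha
  · obtain rfl : b = 1 := by linarith
    linarith
  · have := mul_pos ha hA'
    have := mul_nonneg hb hB'.le
    linarith

/-- A triangle `A B C` with sides on the initial segments `E`, `s`, `u`. -/
structure Triple (Δ : TBA) (E s u : Set Pt) (A B C : Pt) : Prop where
  hE : E ∈ Δ.Sbar
  hs : s ∈ Δ.Sbar
  hu : u ∈ Δ.Sbar
  hAE : A ∈ E
  hAs : A ∈ s
  hBE : B ∈ E
  hBu : B ∈ u
  hCs : C ∈ s
  hCu : C ∈ u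
  nA : Δ.side u A ≠ 0
  nB : Δ.side s B ≠ 0
  nC : Δ.side E C ≠ 0

/-- A triangle in which no chord cuts off `B`, and two chords cutting off the same one of the
other vertices do not meet. -/
structure Wing (Δ : TBA) (E s u : Set Pt) (A B C : Pt) : Prop extends Δ.Triple E s u A B C where
  noB : ∀ r ∈ Δ.Sbar, ¬ Δ.Cut r B A C
  disjA : ∀ h ∈ Δ.Sbar, ∀ h' ∈ Δ.Sbar, h ≠ h' → Δ.Cut h A B C → Δ.Cut h' A B C →
    ∀ p ∈ h, p ∈ h' → ¬ Δ.InHull A B C p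
  disjC : ∀ h ∈ Δ.Sbar, ∀ h' ∈ Δ.Sbar, h ≠ h' → Δ.Cut h C B A → Δ.Cut h' C B A →
    ∀ p ∈ h, p ∈ h' → ¬ Δ.InHull A B C p

namespace Triple

variable {E s u : Set Pt} {A B C : Pt}

theorem symm (W : Δ.Triple E s u A B C) : Δ.Triple u s E C B A :=
  ⟨W.hu, W.hs, W.hE, W.hCu, W.hCs, W.hBu, W.hBE, W.hAs, W.hAE, W.nC, W.nB, W.nA⟩

/-- Relabelling the vertices `A B C` as `B C A`. -/
theorem rotate (W : Δ.Triple E s u A B C) : Δ.Triple u E s B C A :=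
  ⟨W.hu, W.hE, W.hs, W.hBu, W.hBE, W.hCu, W.hCs, W.hAE, W.hAs, W.nB, W.nC, W.nA⟩

variable (W : Δ.Triple E s u A B C)
include W

theorem E_ne_s : E ≠ s := fun h => W.nC (side_eq_zero (bl W.hE) (h ▸ W.hCs))
theorem s_ne_u : s ≠ u := W.symm.E_ne_s.symm
theorem E_ne_u : E ≠ u := W.rotate.E_ne_s.symm
theorem A_ne_C : A ≠ C := fun h => W.nA (h ▸ side_eq_zero (bl W.hu) W.hCu)
theorem A_ne_B : A ≠ B := W.rotate.A_ne_C.symm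

theorem ne_E_of_sep {r : Set Pt} {p p' : Pt} (hp : Δ.InHull A B C p) (hp' : Δ.InHull A B C p')
    (h : Δ.side r p * Δ.side r p' < 0) : r ≠ E := by
  rintro rfl
  have key : ∀ q, Δ.InHull A B C q → 0 ≤ Δ.side r C * Δ.side r q := fun q hq =>
    hq.nonneg (by simp [side_eq_zero (bl W.hE) W.hAE]) (by simp [side_eq_zero (bl W.hE) W.hBE])
      (mul_self_nonneg _)
  linarith [nonneg_trans (swap_nonneg (key p hp)) W.nC (key p' hp')]

theorem side_ne_zero_A {r : Set Pt} (hr : r ∈ Δ.Sbar) (hE : r ≠ E) (hs : r ≠ s) :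
    Δ.side r A ≠ 0 := fun h => by
  rcases conc hr W.hE W.hs W.E_ne_s (mem_of_side_eq_zero (bl hr) (mem_tri (bl W.hE) W.hAE) h)
    W.hAE W.hAs with h | h
  exacts [hE h, hs h]

/-- A segment separating two points of a triangle cuts off a vertex. -/
theorem cut_of_sep {r : Set Pt} (hr : r ∈ Δ.Sbar) {p p' : Pt} (hp : Δ.InHull A B C p)
    (hp' : Δ.InHull A B C p') (h : Δ.side r p * Δ.side r p' < 0) :
    Δ.Cut r A B C ∨ Δ.Cut r B A C ∨ Δ.Cut r C B A := by
  have nE := W.ne_E_of_sep hp hp' h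
  have nu := W.rotate.ne_E_of_sep hp.rotate hp'.rotate h
  have ns := W.rotate.rotate.ne_E_of_sep hp.rotate.rotate hp'.rotate.rotate h
  have hA := W.side_ne_zero_A hr nE ns
  have hB := W.rotate.side_ne_zero_A hr nu nE
  have hC := W.symm.side_ne_zero_A hr nu ns
  rcases lt_or_gt_of_ne (mul_ne_zero hA hB) with hAB | hAB
  · rcases lt_or_gt_of_ne (mul_ne_zero hA hC) with hAC | hAC
    · exact Or.inl ⟨hAB, hAC⟩
    · exact Or.inr (Or.inl ⟨swap_neg hAB, sgn_np (swap_neg hAB) hAC⟩)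
  · rcases lt_or_gt_of_ne (mul_ne_zero hA hC) with hAC | hAC
    · exact Or.inr (Or.inr ⟨sgn_np (swap_neg hAC) hAB, swap_neg hAC⟩)
    · exfalso
      have key : ∀ q, Δ.InHull A B C q → 0 < Δ.side r A * Δ.side r q := fun q hq =>
        hq.pos (mul_self_pos.2 hA) hAB hAC
      linarith [sgn_pp (swap_pos (key p hp)) (key p' hp')]

end Triple

namespace Wing

variable {E s u : Set Pt} {A B C : Pt}

theorem symm (W : Δ.Wing E s u A B C) : Δ.Wing u s E C B A where
  toTriple := W.toTriple.symm
  noB := fun r hr h => W.noB r hr h.swap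
  disjA := fun h hh h' hh' hne hc hc' p hp hp' hD => W.disjC h hh h' hh' hne hc hc' p hp hp' hD.symm
  disjC := fun h hh h' hh' hne hc hc' p hp hp' hD => W.disjA h hh h' hh' hne hc hc' p hp hp' hD.symm

/-- The segment `E`, or a chord cutting off `C`. -/
def IsC (Δ : TBA) (E : Set Pt) (A B C : Pt) (c : Set Pt) : Prop :=
  c ∈ Δ.Sbar ∧ (c = E ∨ Δ.Cut c C B A)

variable (W : Δ.Wing E s u A B C)
include W

theorem cut_of_sep {r : Set Pt} (hr : r ∈ Δ.Sbar) {p p' : Pt} (hp : Δ.InHull A B C p)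
    (hp' : Δ.InHull A B C p') (h : Δ.side r p * Δ.side r p' < 0) :
    Δ.Cut r A B C ∨ Δ.Cut r C B A := by
  rcases W.toTriple.cut_of_sep hr hp hp' h with h | h | h
  exacts [Or.inl h, absurd h (W.noB r hr), Or.inr h]

theorem ne_of_cut {h c : Set Pt} (hh : IsC Δ u C B A h) (hc : IsC Δ E A B C c) : h ≠ c := by
  rintro rfl
  obtain ⟨-, rfl | hh⟩ := hh
  · rcases hc.2 with h | h
    · exact W.E_ne_u h.symm
    · exact left_ne_of_neg h.1 (side_eq_zero (bl W.hu) W.hCu)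
  · rcases hc.2 with rfl | h'
    · exact left_ne_of_neg hh.1 (side_eq_zero (bl W.hE) W.hAE)
    · linarith [h'.1, hh.pos, mul_comm (Δ.side h C) (Δ.side h B)]

theorem IsC.ne_s {c : Set Pt} (hc : IsC Δ E A B C c) : c ≠ s := by
  rintro rfl
  rcases hc.2 with h | h
  · exact W.E_ne_s h.symm
  · exact left_ne_of_neg h.1 (side_eq_zero (bl W.hs) W.hCs)

/-- Another chord cutting off `C` does not separate points of such a segment. -/
theorem IsC.side_pos {c r : Set Pt} (hc : IsC Δ E A B C c) (hr : r ∈ Δ.Sbar)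
    (hrC : Δ.Cut r C B A) (hne : r ≠ c) {p p' : Pt} (hp : p ∈ c) (hp' : p' ∈ c)
    (hD : Δ.InHull A B C p) (hD' : Δ.InHull A B C p') : 0 < Δ.side r p * Δ.side r p' := by
  rcases hc.2 with rfl | hcC
  · have key : ∀ q ∈ c, Δ.InHull A B C q → 0 < Δ.side r A * Δ.side r q := fun q hq hqD =>
      hqD.pos_of_edge (side_eq_zero (bl W.hE) W.hAE) (side_eq_zero (bl W.hE) W.hBE) W.nC
        (side_eq_zero (bl W.hE) hq) (mul_self_pos.2 (right_ne_of_neg hrC.2)) (swap_pos hrC.pos)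
    exact sgn_pp (swap_pos (key p hp hD)) (key p' hp' hD')
  · by_contra! hle
    have key : ∀ q ∈ c, Δ.InHull A B C q → Δ.side r q ≠ 0 := fun q hq hqD h0 =>
      W.disjC r hr c hc.1 hne hrC hcC q (mem_of_side_eq_zero (bl hr) (mem_tri (bl hc.1) hq) h0)
        hq hqD
    obtain ⟨q, hq, hqr⟩ := exists_cross (bl hr) (mem_tri (bl hc.1) hp) (mem_tri (bl hc.1) hp')
      (hle.lt_of_ne (mul_ne_zero (key p hp hD) (key p' hp' hD')))
    exact key q (mem_of_openSegment (bl hc.1) hp hp' hq) (hD.of_openSegment hD' hq)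
      (side_eq_zero (bl hr) hqr)

theorem IsC.adj {c : Set Pt} (hc : IsC Δ E A B C c) {p p' : Pt} (hp : p ∈ c) (hp' : p' ∈ c)
    (hD : Δ.InHull A B C p) (hD' : Δ.InHull A B C p')
    (H : ∀ r ∈ Δ.Sbar, Δ.Cut r A B C → 0 ≤ Δ.side r p * Δ.side r p') : Δ.Adj p p' := by
  intro r hr
  by_contra! hsep
  rcases W.cut_of_sep hr hD hD' hsep with h | h
  · linarith [H r hr h]
  · have hne : r ≠ c := fun h' => left_ne_of_neg hsep (h' ▸ side_eq_zero (bl hc.1) hp)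
    linarith [hc.side_pos W hr h hne hp hp' hD hD']

end Wing

namespace Wing

variable {E s u : Set Pt} {A B C : Pt}

/-- The position on the line `A C` at which the segment `r` crosses it. -/
def pos (Δ : TBA) (A C : Pt) (r : Set Pt) : ℝ := Δ.side r A / (Δ.side r A - Δ.side r C)

theorem side_param (r : Set Pt) (h : Δ.side r A - Δ.side r C ≠ 0) (t : ℝ) :
    Δ.side r ((1 - t) • A + t • C) = (Δ.side r A - Δ.side r C) * (pos Δ A C r - t) := by
  rw [side_comb r (by ring), pos, mul_sub, mul_div_cancel₀ _ h]
  ring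

theorem pos_mem {r : Set Pt} (h : Δ.side r A - Δ.side r C ≠ 0)
    (h' : Δ.side r A * Δ.side r C ≤ 0) : 0 ≤ pos Δ A C r ∧ pos Δ A C r ≤ 1 := by
  have h2 : 0 < (Δ.side r A - Δ.side r C) ^ 2 := by positivity
  have h3 : pos Δ A C r = (Δ.side r A * (Δ.side r A - Δ.side r C)) /
      (Δ.side r A - Δ.side r C) ^ 2 := by rw [pos]; field_simp
  rw [h3, div_le_one h2]
  exact ⟨div_nonneg (by nlinarith [sq_nonneg (Δ.side r A)]) h2.le,
    by nlinarith [sq_nonneg (Δ.side r C)]⟩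

theorem inHull_param {t : ℝ} (h0 : 0 ≤ t) (h1 : t ≤ 1) :
    Δ.InHull A B C ((1 - t) • A + t • C) :=
  ⟨1 - t, 0, t, by linarith, le_rfl, h0, by ring, fun r => by rw [side_comb r (by ring)]; ring⟩

theorem cut_sub_ne {r : Set Pt} {X Y Z : Pt} (h : Δ.Cut r X Y Z) :
    Δ.side r Z - Δ.side r X ≠ 0 := fun h0 => by
  have := h.2
  rw [sub_eq_zero.1 h0] at this
  linarith [mul_self_nonneg (Δ.side r X)]

variable (W : Δ.Wing E s u A B C)
include W

theorem IsC.bounds {c : Set Pt} (hc : IsC Δ E A B C c) :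
    Δ.side c A - Δ.side c C ≠ 0 ∧ Δ.side c A * Δ.side c C ≤ 0 := by
  rcases hc.2 with rfl | h
  · rw [side_eq_zero (bl W.hE) W.hAE]
    exact ⟨fun h => W.nC (by linarith), by simp⟩
  · exact ⟨cut_sub_ne h, by linarith [h.2, mul_comm (Δ.side c C) (Δ.side c A)]⟩

theorem IsC.bounds' {h : Set Pt} (hh : IsC Δ u C B A h) :
    Δ.side h A - Δ.side h C ≠ 0 ∧ Δ.side h A * Δ.side h C ≤ 0 := by
  obtain ⟨h1, h2⟩ := hh.bounds W.symm
  exact ⟨fun h => h1 (by linarith), by linarith [mul_comm (Δ.side h C) (Δ.side h A)]⟩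

theorem param_mem_s {t : ℝ} (h0 : 0 ≤ t) (h1 : t ≤ 1) : (1 - t) • A + t • C ∈ s := by
  refine mem_of_side_eq_zero (bl W.hs) (Δ.convex_tri (mem_tri (bl W.hs) W.hAs)
    (mem_tri (bl W.hs) W.hCs) (by linarith) h0 (by ring)) ?_
  rw [side_comb s (by ring), side_eq_zero (bl W.hs) W.hAs, side_eq_zero (bl W.hs) W.hCs]
  ring

/-- Two adjacent vertices on `A C`, the first on a chord cutting off `C` and the second on a chord
cutting off `A`. -/
theorem exists_adj : ∃ c h z q, IsC Δ E A B C c ∧ IsC Δ u C B A h ∧ z ∈ c ∧ z ∈ s ∧ q ∈ h ∧ q ∈ s ∧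
    Δ.InHull A B C z ∧ Δ.InHull A B C q ∧ Δ.Adj z q ∧ 0 < Δ.side h A * Δ.side h z ∧
    0 < Δ.side c C * Δ.side c q := by
  obtain ⟨h, hh, hmin⟩ := exists_min_image {h | IsC Δ u C B A h} (pos Δ A C)
    (finite_Sbar.subset fun r hr => hr.1) ⟨u, W.hu, Or.inl rfl⟩
  obtain ⟨nh, hh'⟩ := IsC.bounds' W hh
  obtain ⟨h0, h1⟩ := pos_mem nh hh'
  have hE0 : pos Δ A C E = 0 := by rw [pos, side_eq_zero (bl W.hE) W.hAE, zero_div]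
  obtain ⟨c, ⟨hc, hch⟩, hmax⟩ := exists_max_image
    {c | IsC Δ E A B C c ∧ pos Δ A C c ≤ pos Δ A C h} (pos Δ A C)
    (finite_Sbar.subset fun r hr => hr.1.1) ⟨E, ⟨W.hE, Or.inl rfl⟩, hE0 ▸ h0⟩
  obtain ⟨nc, hc'⟩ := IsC.bounds W hc
  obtain ⟨c0, c1⟩ := pos_mem nc hc'
  have memc : (1 - pos Δ A C c) • A + pos Δ A C c • C ∈ c := mem_of_side_eq_zero (bl hc.1)
    (mem_tri (bl W.hs) (W.param_mem_s c0 c1)) (by rw [side_param c nc]; ring)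
  have memh : (1 - pos Δ A C h) • A + pos Δ A C h • C ∈ h := mem_of_side_eq_zero (bl hh.1)
    (mem_tri (bl W.hs) (W.param_mem_s h0 h1)) (by rw [side_param h nh]; ring)
  have hlt : pos Δ A C c < pos Δ A C h := by
    refine hch.lt_of_ne fun he => ?_
    rcases conc hh.1 hc.1 W.hs (IsC.ne_s W hc) memh (he ▸ memc) (W.param_mem_s h0 h1) with h' | h'
    · exact W.ne_of_cut hh hc h'
    · exact IsC.ne_s W.symm hh h'
  refine ⟨c, h, _, _, hc, hh, memc, W.param_mem_s c0 c1, memh, W.param_mem_s h0 h1,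
    inHull_param c0 c1, inHull_param h0 h1, ?_, ?_, ?_⟩
  · intro r hr
    by_contra! hsep
    have key : ∀ r, Δ.side r A - Δ.side r C ≠ 0 →
        Δ.side r ((1 - pos Δ A C c) • A + pos Δ A C c • C) *
        Δ.side r ((1 - pos Δ A C h) • A + pos Δ A C h • C) < 0 →
        pos Δ A C c < pos Δ A C r ∧ pos Δ A C r < pos Δ A C h := by
      intro r nr hr
      rw [side_param r nr, side_param r nr] at hr
      have h2 : 0 < (Δ.side r A - Δ.side r C) ^ 2 := by positivity
      have h3 : (pos Δ A C r - pos Δ A C c) * (pos Δ A C r - pos Δ A C h) < 0 := by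
        by_contra! h4
        nlinarith [mul_nonneg h2.le h4]
      constructor <;> by_contra! <;> nlinarith
    rcases W.cut_of_sep hr (inHull_param c0 c1) (inHull_param h0 h1) hsep with h' | h'
    · have h2 : IsC Δ u C B A r := ⟨hr, Or.inr h'⟩
      linarith [hmin r h2, (key r (IsC.bounds' W h2).1 hsep).2]
    · have h2 : IsC Δ E A B C r := ⟨hr, Or.inr h'⟩
      obtain ⟨h3, h4⟩ := key r (IsC.bounds W h2).1 hsep
      linarith [hmax r ⟨h2, h4.le⟩]
  · have hA := side_param h nh 0
    rw [sub_zero, one_smul, zero_smul, add_zero, sub_zero] at hA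
    rw [side_param h nh]
    refine lt_of_lt_of_eq
      (mul_pos (mul_self_pos.2 nh) (mul_pos (c0.trans_lt hlt) (sub_pos.2 hlt))) ?_
    linear_combination -(Δ.side h A - Δ.side h C) * (pos Δ A C h - pos Δ A C c) * hA
  · have hC := side_param c nc 1
    rw [sub_self, zero_smul, one_smul, zero_add] at hC
    rw [side_param c nc]
    refine lt_of_lt_of_eq (mul_pos (mul_self_pos.2 nc)
      (mul_pos (sub_pos.2 (hlt.trans_le h1)) (sub_pos.2 hlt))) ?_
    linear_combination -(Δ.side c A - Δ.side c C) * (pos Δ A C c - pos Δ A C h) * hC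

end Wing

theorem openSegment_trichotomy {s : Set Pt} (hs : s ∈ Δ.Sbar) {u v w : Pt} (hu : u ∈ s)
    (hv : v ∈ s) (hw : w ∈ s) (huv : u ≠ v) (hvw : v ≠ w) (huw : u ≠ w) :
    v ∈ openSegment ℝ u w ∨ w ∈ openSegment ℝ v u ∨ u ∈ openSegment ℝ w v := by
  obtain ⟨a, b, -, rfl, -, -⟩ := exists_segment (bl hs)
  have h := collinear_triple_of_mem_affineSpan_pair (mem_segment_iff_wbtw.1 hu).mem_affineSpan
    (mem_segment_iff_wbtw.1 hv).mem_affineSpan (mem_segment_iff_wbtw.1 hw).mem_affineSpan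
  rcases h.wbtw_or_wbtw_or_wbtw with h | h | h
  · exact Or.inl (mem_openSegment_of_ne_left_right huv hvw.symm (mem_segment_iff_wbtw.2 h))
  · exact Or.inr (Or.inl (mem_openSegment_of_ne_left_right hvw huw (mem_segment_iff_wbtw.2 h)))
  · exact Or.inr (Or.inr (mem_openSegment_of_ne_left_right huw.symm huv.symm
      (mem_segment_iff_wbtw.2 h)))

theorem sep_of_sep {r : Set Pt} {p q x : Pt} (hx : x ∈ openSegment ℝ p q)
    (h : Δ.side r p * Δ.side r x < 0) : Δ.side r p * Δ.side r q < 0 := by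
  obtain ⟨a, b, ha, hb, hab⟩ := side_openSegment (Δ := Δ) r hx
  by_contra! h'
  rw [hab] at h
  linarith [mul_nonneg ha.le (mul_self_nonneg (Δ.side r p)), mul_nonneg hb.le h']

namespace Wing

variable {E s u : Set Pt} {A B C : Pt} (W : Δ.Wing E s u A B C)
include W

/-- A chord cutting off `A` meets the side `A B`. -/
theorem IsC.foot {h : Set Pt} (hh : IsC Δ u C B A h) :
    ∃ r ∈ h, r ∈ E ∧ Δ.InHull A B C r ∧ r ≠ A := by
  rcases hh.2 with rfl | hA
  · exact ⟨B, W.hBu, W.hBE, (inHull_mid A B C), W.A_ne_B.symm⟩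
  · obtain ⟨r, hr, hrh⟩ := exists_cross (bl hh.1) (mem_tri (bl W.hE) W.hAE)
      (mem_tri (bl W.hE) W.hBE) hA.1
    refine ⟨r, hrh, mem_of_openSegment (bl W.hE) W.hAE W.hBE hr,
      (inHull_left A B C).of_openSegment (inHull_mid A B C) hr, ?_⟩
    rintro rfl
    exact left_ne_of_neg hA.1 (side_eq_zero (bl hh.1) hrh)

theorem IsC.meet {c h : Set Pt} (hc : IsC Δ E A B C c) (hh : IsC Δ u C B A h) {q r : Pt}
    (hqh : q ∈ h) (hq : Δ.InHull A B C q) (hrh : r ∈ h) (hrE : r ∈ E) (hr : Δ.InHull A B C r)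
    (hcq : 0 < Δ.side c C * Δ.side c q) : ∃ w ∈ c, w ∈ h ∧ Δ.InHull A B C w := by
  rcases hc.2 with rfl | hC
  · exact ⟨r, hrE, hrh, hr⟩
  · have h1 : 0 < Δ.side c A * Δ.side c r := hr.pos_of_edge (side_eq_zero (bl W.hE) W.hAE)
      (side_eq_zero (bl W.hE) W.hBE) W.nC (side_eq_zero (bl W.hE) hrE)
      (mul_self_pos.2 (right_ne_of_neg hC.2)) (swap_pos hC.pos)
    obtain ⟨w, hw, hwc⟩ := exists_cross (bl hc.1) (mem_tri (bl hh.1) hqh) (mem_tri (bl hh.1) hrh)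
      (sgn_pn (swap_pos hcq) (sgn_np hC.2 h1))
    exact ⟨w, hwc, mem_of_openSegment (bl hh.1) hqh hrh hw, hq.of_openSegment hr hw⟩

/-- The chord cutting off `C` in `exists_adj` is `E`. -/
theorem eq_E (hΔ : Δ.Strong) {y₀ : Pt} (hy₀ : y₀ ∈ Δ.tri)
    (hy₀B : Δ.side s y₀ * Δ.side s B < 0)
    (hext : ∃ y ∈ s, Δ.side u y * Δ.side u A < 0 ∨ Δ.side E y * Δ.side E C < 0)
    {c h : Set Pt} {z q : Pt} (hc : IsC Δ E A B C c) (hh : IsC Δ u C B A h) (hzc : z ∈ c)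
    (hzs : z ∈ s) (hqh : q ∈ h) (hqs : q ∈ s) (hz : Δ.InHull A B C z) (hq : Δ.InHull A B C q)
    (hzq : Δ.Adj z q) (hhz : 0 < Δ.side h A * Δ.side h z) (hcq : 0 < Δ.side c C * Δ.side c q) :
    c = E := by
  by_contra hcE
  have hcut : Δ.Cut c C B A := hc.2.resolve_left hcE
  have hcs : c ≠ s := hc.ne_s W
  have hhs : h ≠ s := IsC.ne_s W.symm hh
  have hhc : h ≠ c := W.ne_of_cut hh hc
  have hzh : z ∉ h := fun h' => right_ne_of_pos hhz (side_eq_zero (bl hh.1) h')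
  have hqc : q ∉ c := fun h' => right_ne_of_pos hcq (side_eq_zero (bl hc.1) h')
  have hzA : A ≠ z := by
    rintro rfl
    exact right_ne_of_neg hcut.2 (side_eq_zero (bl hc.1) hzc)
  have hcqA : Δ.side c q * Δ.side c A < 0 := sgn_pn (swap_pos hcq) hcut.2
  obtain ⟨r, hrh, hrE, hr, hrA⟩ := hh.foot W
  obtain ⟨w, hwc, hwh, hw⟩ := hc.meet W hh hqh hq hrh hrE hr hcq
  have hAT : A ∈ Δ.tri := mem_tri (bl W.hs) W.hAs
  have hcS : c ∈ Δ.S := mem_S_of_notMem hc.1 <|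
    notMem_triEdges_of_sep (mem_tri (bl W.hs) hqs) hAT hcqA
  have azw : Δ.Adj z w := hc.adj W hzc hwc hz hw fun v hv hvA => by
    by_cases hvh : v = h
    · rw [hvh, side_eq_zero (bl hh.1) hwh, mul_zero]
    · have h1 := IsC.side_pos W.symm hh hv hvA hvh hqh hwh hq.symm hw.symm
      exact nonneg_trans (hzq v hv) (left_ne_of_pos h1) h1.le
  have aqw : Δ.Adj q w := IsC.adj W.symm hh hqh hwh hq.symm hw.symm fun v hv hvC => by
    by_cases hvc : v = c
    · rw [hvc, side_eq_zero (bl hc.1) hwc, mul_zero]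
    · have h1 := hc.side_pos W hv hvC hvc hzc hwc hz hw
      exact nonneg_trans (hzq.symm v hv) (left_ne_of_pos h1) h1.le
  obtain ⟨z', hz's, hz'z, azz', hz', l, hl, hls, hz'l⟩ :=
    exists_next W.hs hc.1 hcs.symm hzs hzc W.hAs hzA
  have hcqz' : Δ.side c q * Δ.side c z' < 0 := sgn_np hcqA (swap_pos hz')
  have hz'A : z' ≠ A → z' ∈ openSegment ℝ A z := fun hne => by
    rcases openSegment_trichotomy W.hs W.hAs hz's hzs hne.symm hz'z hzA with h1 | h1 | h1
    · exact h1
    · have := sep_of_mem_openSegment h1 (side_eq_zero (bl hc.1) hzc) (left_ne_of_pos hz')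
      linarith
    · have := sep_of_mem_openSegment h1 (side_eq_zero (bl W.hE) W.hAE)
        (side_ne_zero W.hs W.hE W.E_ne_s.symm W.hAs W.hAE hzs hzA.symm)
      linarith [azz' E W.hE]
  have hz'D : Δ.InHull A B C z' := by
    by_cases h1 : z' = A
    · rw [h1]; exact inHull_left A B C
    · exact (inHull_left A B C).of_openSegment hz (hz'A h1)
  have hzq' : z ≠ q := fun h' => hzh (h' ▸ hqh)
  have hwz : w ≠ z := fun h' => hzh (h' ▸ hwh)
  have hwq : w ≠ q := fun h' => hqc (h' ▸ hwc)
  have hvz : ∀ v ∈ Δ.Sbar, Δ.Cut v A B C → Δ.side v z ≠ 0 := fun v hv hvA h0 => by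
    rcases conc hv hc.1 W.hs hcs (mem_of_side_eq_zero (bl hv) (mem_tri (bl W.hs) hzs) h0) hzc hzs
      with h1 | h1
    · exact W.ne_of_cut ⟨hv, Or.inr hvA⟩ hc h1
    · exact left_ne_of_neg hvA.1 (h1 ▸ side_eq_zero (bl W.hs) W.hAs)
  by_cases hlC : IsC Δ E A B C l
  · have hlc : l ≠ c := fun h' => left_ne_of_pos hz' (side_eq_zero (bl hc.1) (h' ▸ hz'l))
    have hlz : 0 < Δ.side l C * Δ.side l z := by
      rcases hlC.2 with rfl | hlcut
      · refine lt_of_le_of_ne (hz.nonneg (by simp [side_eq_zero (bl W.hE) W.hAE])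
          (by simp [side_eq_zero (bl W.hE) W.hBE]) (mul_self_nonneg _)) (Ne.symm (mul_ne_zero W.nC
          (side_ne_zero W.hs W.hE W.E_ne_s.symm W.hAs W.hAE hzs hzA.symm)))
      · have hne : z' ≠ A := fun h1 => right_ne_of_neg hlcut.2 (side_eq_zero (bl hl) (h1 ▸ hz'l))
        exact sgn_nn hlcut.2 (sep_of_mem_openSegment (hz'A hne) (side_eq_zero (bl hl) hz'l)
          (right_ne_of_neg hlcut.2))
    have hql : q ∉ l := fun h' => by
      rcases conc hl hh.1 W.hs hhs h' hqh hqs with h1 | h1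
      exacts [W.ne_of_cut hh hlC h1.symm, hls h1]
    have hlq : 0 < Δ.side l C * Δ.side l q := sgn_pp hlz <| lt_of_le_of_ne (hzq l hl) <| Ne.symm <|
      mul_ne_zero (right_ne_of_pos hlz) fun h0 =>
        hql (mem_of_side_eq_zero (bl hl) (mem_tri (bl W.hs) hqs) h0)
    obtain ⟨w', hw'l, hw'h, hw'⟩ := hlC.meet W hh hqh hq hrh hrE hr hlq
    have aww' : Δ.Adj w w' := IsC.adj W.symm hh hwh hw'h hw.symm hw'.symm fun v hv hvC => by
      by_cases hvc : v = c
      · rw [hvc, side_eq_zero (bl hc.1) hwc, zero_mul]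
      by_cases hvl : v = l
      · rw [hvl, side_eq_zero (bl hl) hw'l, mul_zero]
      have h1 := hc.side_pos W hv hvC hvc hzc hwc hz hw
      have h2 := hlC.side_pos W hv hvC hvl hz'l hw'l hz'D hw'
      exact nonneg_trans (swap_pos h1).le (left_ne_of_pos h1)
        (nonneg_trans (azz' v hv) (left_ne_of_pos h2) h2.le)
    have azw' : Δ.Adj z' w' := hlC.adj W hz'l hw'l hz'D hw' fun v hv hvA => by
      by_cases hvh : v = h
      · rw [hvh, side_eq_zero (bl hh.1) hw'h, mul_zero]
      have h1 := IsC.side_pos W.symm hh hv hvA hvh hqh hw'h hq.symm hw'.symm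
      exact nonneg_trans (azz'.symm v hv) (hvz v hv hvA)
        (nonneg_trans (hzq v hv) (left_ne_of_pos h1) h1.le)
    have L : Δ.Ladder s h c l q z z' w w' := ⟨W.hs, hh.1, hc.1, hl, hhs.symm, hqs, hqh, hzs, hz's,
      hwh, hw'h, hzc, hwc, hz'l, hw'l, hcqz',
      sgn_np hcqz' (hlC.side_pos W hc.1 hcut hlc.symm hz'l hw'l hz'D hw'),
      hzq.symm, aqw, azw, azz', aww', azw'⟩
    have hsw : 0 < Δ.side s B * Δ.side s w := lt_of_le_of_ne
      (hw.nonneg (by simp [side_eq_zero (bl W.hs) W.hAs]) (mul_self_nonneg _)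
        (by simp [side_eq_zero (bl W.hs) W.hCs]))
      (Ne.symm (mul_ne_zero W.nB (side_ne_zero hh.1 W.hs hhs hqh hqs hwh hwq)))
    obtain ⟨v, hvh, hv⟩ := exists_extend W.hs hh.1 hhs.symm hqs hqh hy₀ (left_ne_of_neg hy₀B)
    have hvw : Δ.side s v * Δ.side s w < 0 := sgn_np (sgn_pn hv hy₀B) hsw
    obtain ⟨y, hys, hy | hy⟩ := hext
    · refine L.false_of_extend_both hΔ hys ?_ hvh hvw
      refine sgn_np (swap_neg ?_) hhz
      rcases hh.2 with rfl | hhcut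
      · exact swap_neg hy
      · exact sep_of_sep (mem_openSegment_of_sep (bl W.hs) (bl W.hu) W.hAs hys W.hCs W.hCu
          (swap_neg hy)) hhcut.2
    · refine L.symm.false_of_extend_far hΔ hvh hvw hys (sgn_np (swap_neg ?_) hlz)
      rcases hlC.2 with rfl | hlcut
      · exact swap_neg hy
      · exact sep_of_sep (mem_openSegment_of_sep (bl W.hs) (bl W.hE) W.hCs hys W.hAs W.hAE
          (swap_neg hy)) hlcut.2
  · have hne : z' ≠ A := by
      rintro rfl
      rcases conc hl W.hE W.hs W.E_ne_s hz'l W.hAE W.hAs with h1 | h1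
      exacts [hlC ⟨hl, Or.inl h1⟩, hls h1]
    have hlz : Δ.side l z ≠ 0 := side_ne_zero W.hs hl hls.symm hz's hz'l hzs hz'z.symm
    have hlA : Δ.side l z * Δ.side l A < 0 := sep_of_mem_openSegment
      (by rw [openSegment_symm]; exact hz'A hne) (side_eq_zero (bl hl) hz'l) hlz
    have hlcut : Δ.Cut l A B C := (W.cut_of_sep hl hz (inHull_left A B C) hlA).resolve_right
      fun h1 => hlC ⟨hl, Or.inr h1⟩
    have hlH : IsC Δ u C B A l := ⟨hl, Or.inr hlcut⟩
    obtain ⟨b, hb, hzb⟩ := exists_block hcS W.hs hcs hzc hzs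
    have hqw : 0 < Δ.side b q * Δ.side b w := aqw.side_B_pos W.hs hc.1 hh.1 hb hzs hzc hqs hqh hwc
      hwh hzq'.symm hwz hzb
    have hqz' : Δ.side b q * Δ.side b z' < 0 := sep_of_mem_openSegment
      (mem_openSegment_of_sep (bl W.hs) (bl hc.1) hqs hz's hzs hzc hcqz')
      (side_eq_zero (Or.inr hb) hzb) (left_ne_of_pos hqw)
    have hwz' : Δ.side b w * Δ.side b z' < 0 := sgn_pn (swap_pos hqw) hqz'
    obtain ⟨hhl, hcon⟩ := hΔ.concurrent hc.1 W.hs hh.1 hl hb hcs hhc hls hzc hzs hzb hwc hwh hz's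
      hz'l hwz hz'z azw azz' hwz'
    obtain ⟨-, hcon'⟩ := hΔ.concurrent W.hs hc.1 hl hh.1 hb hcs.symm hls hhc hzs hzc hzb hz's hz'l
      hwc hwh hz'z hwz azz' azw (swap_neg hwz')
    have hdisj : ∀ x ∈ h, x ∈ l → ¬ Δ.InHull A B C x := fun x hxh hxl hx => by
      have := IsC.side_pos W.symm hh hl hlcut hhl.symm hxh hxh hx.symm hx.symm
      exact left_ne_of_pos this (side_eq_zero (bl hl) hxl)
    have same : ∀ t ∈ Δ.Sbar, (∀ x ∈ t, x ∈ b → ¬ Δ.InHull A B C x) → ∀ p ∈ t, ∀ p' ∈ t,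
        Δ.InHull A B C p → Δ.InHull A B C p' → 0 < Δ.side b p * Δ.side b p' := by
      intro t ht H p hp p' hp' hD hD'
      have key : ∀ x ∈ t, Δ.InHull A B C x → Δ.side b x ≠ 0 := fun x hxt hx h0 =>
        H x hxt (mem_of_side_eq_zero (Or.inr hb) (mem_tri (bl ht) hxt) h0) hx
      by_contra! hle
      obtain ⟨x, hx, hxb⟩ := exists_cross (Or.inr hb) (mem_tri (bl ht) hp) (mem_tri (bl ht) hp')
        (hle.lt_of_ne (mul_ne_zero (key p hp hD) (key p' hp' hD')))
      exact H x (mem_of_openSegment (bl ht) hp hp' hx) hxb (hD.of_openSegment hD' hx)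
    obtain ⟨r', hr'l, hr'E, hr', -⟩ := hlH.foot W
    have h1 := same h hh.1 (fun x hxh hxb => hdisj x hxh (hcon x hxh hxb)) w hwh r hrh hw hr
    have h2 := same l hl (fun x hxl hxb => hdisj x (hcon' x hxl hxb) hxl) z' hz'l r' hr'l hz'D hr'
    have hrr' : Δ.side b r * Δ.side b r' < 0 := sgn_np (sgn_pn (swap_pos h1) hwz') h2
    obtain ⟨y, hy, hyb⟩ := exists_cross (Or.inr hb) (mem_tri (bl W.hE) hrE)
      (mem_tri (bl W.hE) hr'E) hrr'
    have hyE := mem_of_openSegment (bl W.hE) hrE hr'E hy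
    obtain ⟨v, ⟨hv, hvE, hyv⟩, -⟩ := Δ.second_segment E W.hE b hb y hyE hyb
    have hry : r ≠ y := fun h' => left_ne_of_neg hrr' (side_eq_zero (Or.inr hb) (h' ▸ hyb))
    have hvrr' : Δ.side v r * Δ.side v r' < 0 := sep_of_mem_openSegment hy
      (side_eq_zero (bl hv) hyv) (side_ne_zero W.hE hv hvE.symm hyE hyv hrE hry)
    rcases W.cut_of_sep hv hr hr' hvrr' with hvA | hvC
    · have hvh : v ≠ h := fun h' => left_ne_of_neg hvrr' (side_eq_zero (bl hv) (h' ▸ hrh))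
      have hvl : v ≠ l := fun h' => right_ne_of_neg hvrr' (side_eq_zero (bl hv) (h' ▸ hr'l))
      have h3 := IsC.side_pos W.symm hh hv hvA hvh hqh hrh hq.symm hr.symm
      have h4 := IsC.side_pos W.symm hlH hv hvA hvl hr'l hz'l hr'.symm hz'D.symm
      have h5 := nonneg_trans (hzq.symm v hv) (hvz v hv hvA) (azz' v hv)
      linarith [sgn_np (sgn_pn h3 hvrr') h4]
    · have := IsC.side_pos W ⟨W.hE, Or.inl rfl⟩ hv hvC hvE hrE hr'E hr hr'
      linarith

/-- Under the assumptions on a wing, the triangle is a face if `s` extends beyond one of its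
vertices on `s`, and some point of the big triangle lies behind `s`. -/
theorem face (hΔ : Δ.Strong) {y₀ : Pt} (hy₀ : y₀ ∈ Δ.tri) (hy₀B : Δ.side s y₀ * Δ.side s B < 0)
    (hext : ∃ y ∈ s, Δ.side u y * Δ.side u A < 0 ∨ Δ.side E y * Δ.side E C < 0) :
    Δ.Adj A B ∧ Δ.Adj B C ∧ Δ.Adj A C := by
  obtain ⟨c, h, z, q, hc, hh, hzc, hzs, hqh, hqs, hz, hq, hzq, hhz, hcq⟩ := W.exists_adj
  obtain rfl := W.eq_E hΔ hy₀ hy₀B hext hc hh hzc hzs hqh hqs hz hq hzq hhz hcq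
  obtain rfl := W.symm.eq_E hΔ hy₀ hy₀B (hext.imp fun y h => ⟨h.1, h.2.symm⟩) hh hc hqh hqs hzc hzs
    hq.symm hz.symm hzq.symm hcq hhz
  obtain rfl := eq_of_mem_inter W.hs hc.1 W.E_ne_s.symm hzs hzc W.hAs W.hAE
  obtain rfl := eq_of_mem_inter W.hs hh.1 W.s_ne_u hqs hqh W.hCs W.hCu
  refine ⟨fun r hr => ?_, fun r hr => ?_, hzq⟩
  · by_contra! hsep
    rcases W.cut_of_sep hr (inHull_left _ _ _) (inHull_mid _ _ _) hsep with h | h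
    · linarith [hzq r hr, h.2]
    · linarith [hzq r hr, h.2, mul_comm (Δ.side r z) (Δ.side r q)]
  · by_contra! hsep
    rcases W.cut_of_sep hr (inHull_mid _ _ _) (inHull_right _ _ _) hsep with h | h
    · linarith [hzq r hr, h.2]
    · linarith [hzq r hr, h.2, mul_comm (Δ.side r z) (Δ.side r q)]

end Wing

end TBA

/-- Twice the area of the triangle `A B C`. -/
def area (A B C : Pt) : ℝ := |(B.1 - A.1) * (C.2 - A.2) - (B.2 - A.2) * (C.1 - A.1)|

theorem area_swap (A B C : Pt) : area A C B = area A B C := by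
  rw [area, area, ← abs_neg]
  congr 1
  ring

theorem area_rotate (A B C : Pt) : area B C A = area A B C := by
  rw [area, area]
  congr 1
  ring

theorem area_of_comb (A B C : Pt) {a b : ℝ} (hb : 0 ≤ b) (hab : a + b = 1) :
    area A (a • A + b • B) C = b * area A B C := by
  obtain rfl : a = 1 - b := by linarith
  rw [area, area, ← abs_of_nonneg hb, ← abs_mul, abs_of_nonneg hb]
  congr 1
  simp only [Prod.fst_add, Prod.snd_add, Prod.smul_fst, Prod.smul_snd, smul_eq_mul]
  ring

theorem area_openSegment_le {A B B' : Pt} (C : Pt) (h : B' ∈ openSegment ℝ A B) :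
    area A B' C ≤ area A B C := by
  obtain ⟨a, b, ha, hb, hab, rfl⟩ := h
  rw [area_of_comb A B C hb.le hab]
  exact mul_le_of_le_one_left (abs_nonneg _) (by linarith)

theorem area_openSegment_lt {A B B' C : Pt} (hC : area A B C ≠ 0) (h : B' ∈ openSegment ℝ A B) :
    area A B' C < area A B C := by
  obtain ⟨a, b, ha, hb, hab, rfl⟩ := h
  rw [area_of_comb A B C hb.le hab]
  exact mul_lt_of_lt_one_left (lt_of_le_of_ne (abs_nonneg _) hC.symm) (by linarith)

theorem ev_eq_zero_of_area {A B C : Pt} (hAB : A ≠ B) (h : area A B C = 0) {c : ℝ × ℝ × ℝ}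
    (hA : ev c A = 0) (hB : ev c B = 0) : ev c C = 0 := by
  rw [area, abs_eq_zero] at h
  simp only [ev] at hA hB ⊢
  have h1 : B.1 - A.1 ≠ 0 ∨ B.2 - A.2 ≠ 0 := by
    by_contra! h'
    exact hAB (Prod.ext (by linarith [h'.1]) (by linarith [h'.2]))
  rcases h1 with h1 | h1
  · refine mul_left_cancel₀ h1 ?_
    linear_combination (C.1 - A.1) * (hB - hA) + c.2.1 * h + (B.1 - A.1) * hA
  · refine mul_left_cancel₀ h1 ?_
    linear_combination (C.2 - A.2) * (hB - hA) - c.1 * h + (B.2 - A.2) * hA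

namespace TBA

variable {Δ : TBA}

theorem area_ne_zero {E : Set Pt} (hE : E ∈ Δ.Sbar) {A B C : Pt} (hA : A ∈ E) (hB : B ∈ E)
    (hAB : A ≠ B) (hC : Δ.side E C ≠ 0) : area A B C ≠ 0 := fun h =>
  hC (ev_eq_zero_of_area hAB h (side_eq_zero (bl hE) hA) (side_eq_zero (bl hE) hB))

/-- Two crossing chords `s₁ = a₁ b₁` and `s₂ = a₂ b₂` between two segments `E₂` and `E₃`
through `x`. -/
structure Quad (Δ : TBA) (x : Pt) (E₂ E₃ s₁ s₂ : Set Pt) (a₁ a₂ b₁ b₂ p : Pt) : Prop where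
  hE₂ : E₂ ∈ Δ.Sbar
  hE₃ : E₃ ∈ Δ.Sbar
  hs₁ : s₁ ∈ Δ.S
  hs₂ : s₂ ∈ Δ.S
  hE : E₂ ≠ E₃
  hx₂ : x ∈ E₂
  hx₃ : x ∈ E₃
  ha₁ : a₁ ∈ s₁
  ha₁E : a₁ ∈ E₂
  ha₂ : a₂ ∈ s₂
  ha₂E : a₂ ∈ E₂
  hb₁ : b₁ ∈ s₁
  hb₁E : b₁ ∈ E₃
  hb₂ : b₂ ∈ s₂
  hb₂E : b₂ ∈ E₃
  hp₁ : p ∈ s₁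
  hp₂ : p ∈ s₂
  sep₁ : Δ.side s₁ x * Δ.side s₁ a₂ < 0
  sep₂ : Δ.side s₂ x * Δ.side s₂ b₁ < 0
  free : (∀ b ∈ Δ.B, x ∉ b) ∨ E₂ ∈ Δ.S ∨ E₃ ∈ Δ.S

/-- There is a pair of crossing chords spanning an area less than `K`. -/
def HasQuad (Δ : TBA) (K : ℝ) : Prop :=
  ∃ x E₂ E₃ s₁ s₂ a₁ a₂ b₁ b₂ p, Δ.Quad x E₂ E₃ s₁ s₂ a₁ a₂ b₁ b₂ p ∧ area x a₂ b₁ < K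

theorem HasQuad.mono {K L : ℝ} (h : Δ.HasQuad K) (hKL : K ≤ L) : Δ.HasQuad L := by
  obtain ⟨x, E₂, E₃, s₁, s₂, a₁, a₂, b₁, b₂, p, Q, hQ⟩ := h
  exact ⟨x, E₂, E₃, s₁, s₂, a₁, a₂, b₁, b₂, p, Q, hQ.trans_le hKL⟩

namespace Triple

variable {E s u : Set Pt} {A B C : Pt} (W : Δ.Triple E s u A B C)
include W

theorem area_ne_zero : area A B C ≠ 0 := TBA.area_ne_zero W.hE W.hAE W.hBE W.A_ne_B W.nC

theorem ne_of_cut {h : Set Pt} (hh : h ∈ Δ.Sbar) (hc : Δ.Cut h A B C) : h ≠ E ∧ h ≠ s := by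
  constructor
  · rintro rfl
    exact left_ne_of_neg hc.1 (side_eq_zero (bl hh) W.hAE)
  · rintro rfl
    exact left_ne_of_neg hc.1 (side_eq_zero (bl hh) W.hAs)

/-- A point of a chord in the triangle, not on its sides, lies between the ends of the chord. -/
theorem mem_openSegment_of_chord {h : Set Pt} (hh : h ∈ Δ.Sbar) (hc : Δ.Cut h A B C) {p r q : Pt}
    (hp : Δ.InHull A B C p) (hph : p ∈ h) (hrh : r ∈ h) (hqh : q ∈ h) (hrE : r ∈ E) (hqs : q ∈ s)
    (hq : Δ.InHull A B C q) (hr : Δ.InHull A B C r) (hpr : p ≠ r) (hpq : p ≠ q) :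
    p ∈ openSegment ℝ r q := by
  obtain ⟨hhE, hhs⟩ := W.ne_of_cut hh hc
  have hA : A ∉ h := fun h' => left_ne_of_neg hc.1 (side_eq_zero (bl hh) h')
  have hrq : r ≠ q := by
    rintro rfl
    exact hA (eq_of_mem_inter W.hE W.hs W.E_ne_s hrE hqs W.hAE W.hAs ▸ hrh)
  have keyE : ∀ v, Δ.InHull A B C v → 0 ≤ Δ.side E C * Δ.side E v := fun v hv =>
    hv.nonneg (by simp [side_eq_zero (bl W.hE) W.hAE]) (by simp [side_eq_zero (bl W.hE) W.hBE])
      (mul_self_nonneg _)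
  have keys : ∀ v, Δ.InHull A B C v → 0 ≤ Δ.side s B * Δ.side s v := fun v hv =>
    hv.nonneg (by simp [side_eq_zero (bl W.hs) W.hAs]) (mul_self_nonneg _)
      (by simp [side_eq_zero (bl W.hs) W.hCs])
  rcases openSegment_trichotomy hh hrh hph hqh hpr.symm hpq hrq with h1 | h1 | h1
  · exact h1
  · have := sep_of_mem_openSegment h1 (side_eq_zero (bl W.hs) hqs)
      (side_ne_zero hh W.hs hhs hqh hqs hph hpq)
    linarith [nonneg_trans (swap_nonneg (keys p hp)) W.nB (keys r hr)]
  · have := sep_of_mem_openSegment h1 (side_eq_zero (bl W.hE) hrE)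
      (side_ne_zero hh W.hE hhE hrh hrE hqh hrq.symm)
    linarith [nonneg_trans (swap_nonneg (keyE q hq)) W.nC (keyE p hp)]

/-- Two chords cutting off `A` which meet inside the triangle form a smaller pair of crossing
chords. -/
theorem hasQuad (hP : (∀ b ∈ Δ.B, A ∉ b) ∨ E ∈ Δ.S ∨ s ∈ Δ.S) {h h' : Set Pt}
    (hh : h ∈ Δ.Sbar) (hh' : h' ∈ Δ.Sbar) (hne : h ≠ h') (hc : Δ.Cut h A B C)
    (hc' : Δ.Cut h' A B C) {p : Pt} (hp : Δ.InHull A B C p) (hph : p ∈ h) (hph' : p ∈ h') :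
    Δ.HasQuad (area A B C) := by
  have hAT := mem_tri (bl W.hs) W.hAs
  have hBT := mem_tri (bl W.hE) W.hBE
  have hCT := mem_tri (bl W.hs) W.hCs
  obtain ⟨r, hr, hrh⟩ := exists_cross (bl hh) hAT hBT hc.1
  obtain ⟨r', hr', hrh'⟩ := exists_cross (bl hh') hAT hBT hc'.1
  obtain ⟨q, hq, hqh⟩ := exists_cross (bl hh) hAT hCT hc.2
  obtain ⟨q', hq', hqh'⟩ := exists_cross (bl hh') hAT hCT hc'.2
  have hrE := mem_of_openSegment (bl W.hE) W.hAE W.hBE hr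
  have hrE' := mem_of_openSegment (bl W.hE) W.hAE W.hBE hr'
  have hqs := mem_of_openSegment (bl W.hs) W.hAs W.hCs hq
  have hqs' := mem_of_openSegment (bl W.hs) W.hAs W.hCs hq'
  obtain ⟨nE, ns⟩ := W.ne_of_cut hh hc
  obtain ⟨nE', ns'⟩ := W.ne_of_cut hh' hc'
  have iA := inHull_left (Δ := Δ) A B C
  have iB := inHull_mid (Δ := Δ) A B C
  have iC := inHull_right (Δ := Δ) A B C
  have hpE : p ∉ E := fun h0 => (conc W.hE hh hh' hne h0 hph hph').elim (nE ·.symm) (nE' ·.symm)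
  have hps : p ∉ s := fun h0 => (conc W.hs hh hh' hne h0 hph hph').elim (ns ·.symm) (ns' ·.symm)
  have hm := W.mem_openSegment_of_chord hh hc hp hph hrh hqh hrE hqs (iA.of_openSegment iC hq)
    (iA.of_openSegment iB hr) (fun h0 => hpE (h0 ▸ hrE)) (fun h0 => hps (h0 ▸ hqs))
  have hm' := W.mem_openSegment_of_chord hh' hc' hp hph' hrh' hqh' hrE' hqs'
    (iA.of_openSegment iC hq') (iA.of_openSegment iB hr') (fun h0 => hpE (h0 ▸ hrE'))
    (fun h0 => hps (h0 ▸ hqs'))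
  have hrr' : r ≠ r' := fun h0 =>
    (conc W.hE hh hh' hne hrE hrh (h0 ▸ hrh')).elim (nE ·.symm) (nE' ·.symm)
  have key : ∀ {h h' r r' q q'}, h ∈ Δ.Sbar → h' ∈ Δ.Sbar → p ∈ h → p ∈ h' → Δ.Cut h A B C →
      Δ.Cut h' A B C → r ∈ h → r' ∈ h' → q ∈ h → q' ∈ h' → r ∈ E → r' ∈ E → q ∈ s → q' ∈ s →
      h ≠ E → h' ≠ E →
      p ∈ openSegment ℝ r q → r' ∈ openSegment ℝ A B → q ∈ openSegment ℝ A C → r ≠ r' →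
      r ∈ openSegment ℝ A r' → Δ.HasQuad (area A B C) := by
    intro h h' r r' q q' hh hh' hph hph' hc hc' hrh hrh' hqh hqh' hrE hrE' hqs hqs' nE nE' hm hr'
      hq hrr' hrA
    have nA := left_ne_of_neg hc.1
    have nA' := left_ne_of_neg hc'.1
    have h1 : Δ.side h A * Δ.side h r' < 0 :=
      sep_of_mem_openSegment hrA (side_eq_zero (bl hh) hrh) nA
    have nr : Δ.side h' r ≠ 0 := side_ne_zero W.hE hh' nE'.symm hrE' hrh' hrE hrr'
    have h2 : 0 < Δ.side h' A * Δ.side h' r := by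
      by_contra! hle
      have h3 := sep_of_sep hrA (hle.lt_of_ne (mul_ne_zero nA' nr))
      rw [side_eq_zero (bl hh') hrh', mul_zero] at h3
      exact lt_irrefl _ h3
    have h3 : Δ.side h' r * Δ.side h' q < 0 :=
      sep_of_mem_openSegment hm (side_eq_zero (bl hh') hph') nr
    have inS : ∀ {h}, h ∈ Δ.Sbar → Δ.Cut h A B C → h ∈ Δ.S := fun hh hc =>
      mem_S_of_notMem hh (notMem_triEdges_of_sep hAT hBT hc.1)
    refine ⟨A, E, s, h, h', r, r', q, q', p, ⟨W.hE, W.hs, inS hh hc, inS hh' hc', W.E_ne_s, W.hAE,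
      W.hAs, hrh, hrE, hrh', hrE', hqh, hqs, hqh', hqs', hph, hph', h1, sgn_pn h2 h3, hP⟩, ?_⟩
    calc area A r' q ≤ area A r' C := by
          rw [← area_swap, ← area_swap A r']
          exact area_openSegment_le _ hq
      _ < area A B C := area_openSegment_lt W.area_ne_zero hr'
  have nA := left_ne_of_neg hc.1
  have hrA : A ≠ r := fun h0 => nA (side_eq_zero (bl hh) (h0 ▸ hrh))
  have hrA' : A ≠ r' := fun h0 => left_ne_of_neg hc'.1 (side_eq_zero (bl hh') (h0 ▸ hrh'))
  rcases openSegment_trichotomy W.hE W.hAE hrE hrE' hrA hrr' hrA' with h1 | h1 | h1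
  · exact key hh hh' hph hph' hc hc' hrh hrh' hqh hqh' hrE hrE' hqs hqs' nE nE' hm hr' hq hrr' h1
  · rw [openSegment_symm] at h1
    exact key hh' hh hph' hph hc' hc hrh' hrh hqh' hqh hrE' hrE hqs' hqs nE' nE hm' hr hq' hrr'.symm
      h1
  · exfalso
    have hsA : ∀ v ∈ openSegment ℝ A B, 0 < Δ.side s B * Δ.side s v := fun v hv => by
      obtain ⟨a, b, ha, hb, h⟩ := side_openSegment (Δ := Δ) s hv
      rw [h, side_eq_zero (bl W.hs) W.hAs]
      have := mul_pos hb (mul_self_pos.2 W.nB)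
      linarith
    have := sep_of_mem_openSegment h1 (side_eq_zero (bl W.hs) W.hAs) (right_ne_of_pos (hsA r' hr'))
    linarith [sgn_pp (swap_pos (hsA r' hr')) (hsA r hr)]

end Triple

theorem side_pos_of_mem_openSegment {s : Set Pt} {x a w : Pt} (hw : w ∈ openSegment ℝ x a)
    (ha : Δ.side s a = 0) (hx : Δ.side s x ≠ 0) : 0 < Δ.side s x * Δ.side s w := by
  obtain ⟨α, β, hα, -, h⟩ := side_openSegment (Δ := Δ) s hw
  rw [h, ha]
  have := mul_pos hα (mul_self_pos.2 hx)
  linarith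

theorem side_pos_of_sep {r : Set Pt} {u v w : Pt} (hw : w ∈ openSegment ℝ u v)
    (h : Δ.side r w * Δ.side r v < 0) : 0 < Δ.side r w * Δ.side r u := by
  obtain ⟨α, β, hα, hβ, hc⟩ := side_openSegment (Δ := Δ) r hw
  have h1 := mul_pos_of_neg_of_neg (neg_lt_zero.2 hβ) h
  have h2 : 0 < α * (Δ.side r w * Δ.side r u) := by
    have h3 : Δ.side r w * Δ.side r w = Δ.side r w * (α * Δ.side r u + β * Δ.side r v) :=
      congrArg _ hc
    linarith [mul_self_nonneg (Δ.side r w)]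
  exact pos_of_mul_pos_right h2 hα.le

namespace Quad

variable {x : Pt} {E₂ E₃ s₁ s₂ : Set Pt} {a₁ a₂ b₁ b₂ p : Pt}

theorem symm (Q : Δ.Quad x E₂ E₃ s₁ s₂ a₁ a₂ b₁ b₂ p) : Δ.Quad x E₃ E₂ s₂ s₁ b₂ b₁ a₂ a₁ p :=
  ⟨Q.hE₃, Q.hE₂, Q.hs₂, Q.hs₁, Q.hE.symm, Q.hx₃, Q.hx₂, Q.hb₂, Q.hb₂E, Q.hb₁, Q.hb₁E, Q.ha₂,
    Q.ha₂E, Q.ha₁, Q.ha₁E, Q.hp₂, Q.hp₁, Q.sep₂, Q.sep₁, Q.free.imp_right Or.symm⟩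

variable (Q : Δ.Quad x E₂ E₃ s₁ s₂ a₁ a₂ b₁ b₂ p)
include Q

theorem s₁_ne_E₂ : s₁ ≠ E₂ := fun h =>
  left_ne_of_neg Q.sep₁ (side_eq_zero (bl (S_subset Q.hs₁)) (h ▸ Q.hx₂))

theorem s₁_ne_E₃ : s₁ ≠ E₃ := fun h =>
  left_ne_of_neg Q.sep₁ (side_eq_zero (bl (S_subset Q.hs₁)) (h ▸ Q.hx₃))

theorem s₁_ne_s₂ : s₁ ≠ s₂ := fun h =>
  right_ne_of_neg Q.sep₁ (side_eq_zero (bl (S_subset Q.hs₁)) (h ▸ Q.ha₂))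

theorem a₁_mem : a₁ ∈ openSegment ℝ x a₂ :=
  mem_openSegment_of_sep (bl Q.hE₂) (bl (S_subset Q.hs₁)) Q.hx₂ Q.ha₂E Q.ha₁E Q.ha₁ Q.sep₁

theorem side_a₁ : 0 < Δ.side s₂ x * Δ.side s₂ a₁ :=
  side_pos_of_mem_openSegment Q.a₁_mem (side_eq_zero (bl (S_subset Q.hs₂)) Q.ha₂)
    (left_ne_of_neg Q.sep₂)

/-- The chord `s₂` separates the ends of `s₁`. -/
theorem sep_s₂ : Δ.side s₂ a₁ * Δ.side s₂ b₁ < 0 := sgn_pn (swap_pos Q.side_a₁) Q.sep₂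

theorem p_mem : p ∈ openSegment ℝ a₁ b₁ :=
  mem_openSegment_of_sep (bl (S_subset Q.hs₁)) (bl (S_subset Q.hs₂)) Q.ha₁ Q.hb₁ Q.hp₁ Q.hp₂
    Q.sep_s₂

theorem side_E₂_ne {w : Pt} (hw : w ∈ E₃) (hne : w ≠ x) : Δ.side E₂ w ≠ 0 :=
  side_ne_zero Q.hE₃ Q.hE₂ Q.hE.symm Q.hx₃ Q.hx₂ hw hne

theorem a₁_ne_x : a₁ ≠ x := fun h =>
  left_ne_of_neg Q.sep₁ (side_eq_zero (bl (S_subset Q.hs₁)) (h ▸ Q.ha₁))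

theorem a₂_ne_x : a₂ ≠ x := fun h =>
  left_ne_of_neg Q.sep₂ (side_eq_zero (bl (S_subset Q.hs₂)) (h ▸ Q.ha₂))

theorem b₁_ne_x : b₁ ≠ x := Q.symm.a₂_ne_x

theorem a₁_ne_p : a₁ ≠ p := fun h =>
  left_ne_of_neg Q.sep_s₂ (side_eq_zero (bl (S_subset Q.hs₂)) (h ▸ Q.hp₂))

theorem b₁_ne_p : b₁ ≠ p := fun h =>
  right_ne_of_neg Q.sep_s₂ (side_eq_zero (bl (S_subset Q.hs₂)) (h ▸ Q.hp₂))

theorem b₂_ne_p : b₂ ≠ p := Q.symm.a₁_ne_p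

theorem side_E₂_p : Δ.side E₂ p ≠ 0 :=
  side_ne_zero (S_subset Q.hs₁) Q.hE₂ Q.s₁_ne_E₂ Q.ha₁ Q.ha₁E Q.hp₁ Q.a₁_ne_p.symm

/-- The triangle `a₂ a₁ p`. -/
theorem triple_a : Δ.Triple E₂ s₂ s₁ a₂ a₁ p :=
  ⟨Q.hE₂, S_subset Q.hs₂, S_subset Q.hs₁, Q.ha₂E, Q.ha₂, Q.ha₁E, Q.ha₁, Q.hp₂, Q.hp₁,
    right_ne_of_neg Q.sep₁, right_ne_of_pos Q.side_a₁, Q.side_E₂_p⟩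

theorem area_ne_zero : area x a₂ b₁ ≠ 0 :=
  TBA.area_ne_zero Q.hE₂ Q.hx₂ Q.ha₂E Q.a₂_ne_x.symm (Q.side_E₂_ne Q.hb₁E Q.b₁_ne_x)

theorem area_a_le : area a₂ a₁ p ≤ area x a₂ b₁ := by
  have h1 : area a₂ a₁ p ≤ area a₂ a₁ b₂ := by
    rw [← area_swap a₂ a₁, ← area_swap a₂ a₁]
    exact area_openSegment_le _ (openSegment_symm ℝ b₂ a₂ ▸ Q.symm.p_mem)
  have h2 : area a₂ a₁ b₂ ≤ area a₂ x b₂ :=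
    area_openSegment_le _ (openSegment_symm ℝ x a₂ ▸ Q.a₁_mem)
  have h3 : area a₂ x b₂ = area x a₂ b₂ := by
    rw [area_swap, area_rotate]
  have h4 : area x a₂ b₂ ≤ area x a₂ b₁ := by
    rw [← area_swap x a₂, ← area_swap x a₂]
    exact area_openSegment_le _ Q.symm.a₁_mem
  linarith

theorem wing_a (hmin : ¬ Δ.HasQuad (area x a₂ b₁)) : Δ.Wing E₂ s₂ s₁ a₂ a₁ p where
  toTriple := Q.triple_a
  noB r hr hc := by
    have ha₁T := mem_tri (bl Q.hE₂) Q.ha₁E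
    have ha₂T := mem_tri (bl Q.hE₂) Q.ha₂E
    have hpT := mem_tri (bl (S_subset Q.hs₁)) Q.hp₁
    have hrS : r ∈ Δ.S := mem_S_of_notMem hr (notMem_triEdges_of_sep ha₁T ha₂T hc.1)
    obtain ⟨av, hav, havr⟩ := exists_cross (bl hr) ha₁T ha₂T hc.1
    obtain ⟨pv, hpv, hpvr⟩ := exists_cross (bl hr) ha₁T hpT hc.2
    have havE := mem_of_openSegment (bl Q.hE₂) Q.ha₁E Q.ha₂E hav
    have hpvs := mem_of_openSegment (bl (S_subset Q.hs₁)) Q.ha₁ Q.hp₁ hpv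
    have hx1 : Δ.side s₁ x * Δ.side s₁ av < 0 := by
      refine sgn_np Q.sep₁ ?_
      rw [openSegment_symm] at hav
      exact side_pos_of_mem_openSegment hav (side_eq_zero (bl (S_subset Q.hs₁)) Q.ha₁)
        (right_ne_of_neg Q.sep₁)
    have hxa := side_pos_of_sep Q.a₁_mem hc.1
    have hpb := side_pos_of_sep (openSegment_symm ℝ a₁ b₁ ▸ Q.p_mem) (swap_neg hc.2)
    have hxb : Δ.side r x * Δ.side r b₁ < 0 := sgn_pn (swap_pos hxa) (sgn_np hc.2 hpb)
    obtain ⟨bv, hbv, hbvr⟩ := exists_cross (bl hr) (mem_tri (bl Q.hE₂) Q.hx₂)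
      (mem_tri (bl Q.hE₃) Q.hb₁E) hxb
    have hbvE := mem_of_openSegment (bl Q.hE₃) Q.hx₃ Q.hb₁E hbv
    have hxa₂ : Δ.side r x * Δ.side r a₂ < 0 := sgn_pn (swap_pos hxa) hc.1
    exact hmin ⟨x, E₂, E₃, s₁, r, a₁, av, b₁, bv, pv, ⟨Q.hE₂, Q.hE₃, Q.hs₁, hrS, Q.hE, Q.hx₂,
      Q.hx₃, Q.ha₁, Q.ha₁E, havr, havE, Q.hb₁, Q.hb₁E, hbvr, hbvE, hpvs, hpvr, hx1, hxb, Q.free⟩,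
      area_openSegment_lt Q.area_ne_zero (mem_openSegment_of_sep (bl Q.hE₂) (bl hr) Q.hx₂ Q.ha₂E
        havE havr hxa₂)⟩
  disjA h hh h' hh' hne hc hc' q hq hq' hi := hmin <| HasQuad.mono
    (Q.triple_a.hasQuad (Or.inr (Or.inr Q.hs₂)) hh hh' hne hc hc' hi hq hq') Q.area_a_le
  disjC h hh h' hh' hne hc hc' q hq hq' hi := hmin <| HasQuad.mono
    (Q.triple_a.symm.hasQuad (Or.inr (Or.inl Q.hs₁)) hh hh' hne hc hc' hi.symm hq hq') (by
      rw [area_swap, area_rotate, area_rotate]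
      exact Q.area_a_le)

theorem face_a (hΔ : Δ.Strong) (hmin : ¬ Δ.HasQuad (area x a₂ b₁)) :
    Δ.Adj a₂ a₁ ∧ Δ.Adj a₁ p ∧ Δ.Adj a₂ p :=
  (Q.wing_a hmin).face hΔ (mem_tri (bl Q.hE₃) Q.hb₁E) (swap_neg Q.sep_s₂)
    ⟨b₂, Q.hb₂, Or.inl Q.symm.sep_s₂⟩

/-- The blocking segment through the crossing point of a minimal pair of crossing chords. -/
theorem exists_diagonal (hΔ : Δ.Strong) (hmin : ¬ Δ.HasQuad (area x a₂ b₁)) :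
    ∃ b ∈ Δ.B, p ∈ b ∧ x ∈ b ∧ Δ.side b a₁ * Δ.side b b₂ < 0 := by
  obtain ⟨f₁, f₂, f₃⟩ := Q.face_a hΔ hmin
  obtain ⟨g₁, g₂, g₃⟩ := Q.symm.face_a hΔ (by rwa [area_swap])
  obtain ⟨b, hb, hpb⟩ := exists_block Q.hs₁ (S_subset Q.hs₂) Q.s₁_ne_s₂ Q.hp₁ Q.hp₂
  have hs₁ := S_subset Q.hs₁
  have hs₂ := S_subset Q.hs₂
  have h1 : 0 < Δ.side b a₂ * Δ.side b a₁ := f₁.side_B_pos hs₂ hs₁ Q.hE₂ hb Q.hp₂ Q.hp₁ Q.ha₂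
    Q.ha₂E Q.ha₁ Q.ha₁E Q.symm.b₁_ne_p Q.a₁_ne_p hpb
  have h2 : Δ.side b a₂ * Δ.side b b₂ < 0 := sep_of_mem_openSegment
    (openSegment_symm ℝ b₂ a₂ ▸ Q.symm.p_mem) (side_eq_zero (Or.inr hb) hpb) (left_ne_of_pos h1)
  have h3 : Δ.side b a₁ * Δ.side b b₂ < 0 := sgn_pn (swap_pos h1) h2
  refine ⟨b, hb, hpb, ?_, h3⟩
  obtain ⟨-, c₁⟩ := hΔ.concurrent hs₁ hs₂ Q.hE₂ Q.hE₃ hb Q.s₁_ne_s₂ Q.s₁_ne_E₂.symm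
    Q.symm.s₁_ne_E₂.symm Q.hp₁ Q.hp₂ hpb Q.ha₁ Q.ha₁E Q.hb₂ Q.hb₂E Q.a₁_ne_p Q.b₂_ne_p f₂.symm
    g₂.symm h3
  obtain ⟨-, c₂⟩ := hΔ.concurrent hs₂ hs₁ Q.hE₃ Q.hE₂ hb Q.s₁_ne_s₂.symm Q.symm.s₁_ne_E₂.symm
    Q.s₁_ne_E₂.symm Q.hp₂ Q.hp₁ hpb Q.hb₂ Q.hb₂E Q.ha₁ Q.ha₁E Q.b₂_ne_p Q.a₁_ne_p g₂.symm
    f₂.symm (swap_neg h3)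
  have hxT := mem_tri (bl Q.hE₂) Q.hx₂
  by_contra hxb
  have hx0 : Δ.side b x ≠ 0 := fun h => hxb (mem_of_side_eq_zero (Or.inr hb) hxT h)
  have key : ∀ y ∈ E₂, y ∈ E₃ → y ∉ b := fun y h2 h3 hyb =>
    hxb (eq_of_mem_inter Q.hE₂ Q.hE₃ Q.hE h2 h3 Q.hx₂ Q.hx₃ ▸ hyb)
  by_cases h4 : Δ.side b x * Δ.side b a₁ < 0
  · obtain ⟨y, hy, hyb⟩ := exists_cross (Or.inr hb) hxT (mem_tri (bl hs₁) Q.ha₁) h4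
    have hyE := mem_of_openSegment (bl Q.hE₂) Q.hx₂ Q.ha₁E hy
    exact key y hyE (c₁ y hyE hyb) hyb
  · have h5 : Δ.side b x * Δ.side b b₂ < 0 :=
      sgn_pn ((not_lt.1 h4).lt_of_ne (mul_ne_zero hx0 (left_ne_of_neg h3)).symm) h3
    obtain ⟨y, hy, hyb⟩ := exists_cross (Or.inr hb) hxT (mem_tri (bl hs₂) Q.hb₂) h5
    have hyE := mem_of_openSegment (bl Q.hE₃) Q.hx₃ Q.hb₂E hy
    exact key y (c₂ y hyE hyb) hyE hyb

theorem adj_x (hΔ : Δ.Strong) (hmin : ¬ Δ.HasQuad (area x a₂ b₁)) : Δ.Adj x a₁ := by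
  obtain ⟨-, f, -⟩ := Q.face_a hΔ hmin
  obtain ⟨-, g, -⟩ := Q.symm.face_a hΔ (by rwa [area_swap])
  obtain ⟨b, hb, hpb, hxb, -⟩ := Q.exists_diagonal hΔ hmin
  have hs₁ := S_subset Q.hs₁
  have hs₂ := S_subset Q.hs₂
  have hxT := mem_tri (bl Q.hE₂) Q.hx₂
  have hpT := mem_tri (bl hs₁) Q.hp₁
  have mem {r v t} (hr : r ∈ Δ.Sbar) (ht : t ∈ Δ.Sbar) (hv : v ∈ t) (h : Δ.side r v = 0) : v ∈ r :=
    mem_of_side_eq_zero (bl hr) (mem_tri (bl ht) hv) h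
  have cut (r) (hr : r ∈ Δ.Sbar) (h : Δ.side r x * Δ.side r p < 0) : Δ.Cut r x a₁ b₁ := by
    have nx : ∀ E, x ∈ E → r ≠ E := by
      rintro _ hx rfl
      exact left_ne_of_neg h (side_eq_zero (bl hr) hx)
    have np : ∀ s, p ∈ s → r ≠ s := by
      rintro _ hp rfl
      exact right_ne_of_neg h (side_eq_zero (bl hr) hp)
    have ha : Δ.side r a₁ ≠ 0 := fun h0 =>
      (conc hr hs₁ Q.hE₂ Q.s₁_ne_E₂ (mem hr hs₁ Q.ha₁ h0) Q.ha₁ Q.ha₁E).elim (np _ Q.hp₁)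
        (nx _ Q.hx₂)
    have hb : Δ.side r b₂ ≠ 0 := fun h0 =>
      (conc hr hs₂ Q.hE₃ Q.symm.s₁_ne_E₂ (mem hr hs₂ Q.hb₂ h0) Q.hb₂ Q.hb₂E).elim (np _ Q.hp₂)
        (nx _ Q.hx₃)
    have hp := right_ne_of_neg h
    exact ⟨sgn_np h ((f.symm r hr).lt_of_ne (mul_ne_zero hp ha).symm),
      sep_of_sep Q.symm.a₁_mem (sgn_np h ((g.symm r hr).lt_of_ne (mul_ne_zero hp hb).symm))⟩
  intro r hr
  by_contra! h
  have hrp : Δ.side r p ≠ 0 := fun h0 => by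
    rcases conc hr hs₁ hs₂ Q.s₁_ne_s₂ (mem hr hs₁ Q.hp₁ h0) Q.hp₁ Q.hp₂ with rfl | rfl
    · exact right_ne_of_neg h (side_eq_zero (bl hr) Q.ha₁)
    · exact lt_asymm h Q.side_a₁
  have hxp : Δ.side r x * Δ.side r p < 0 :=
    sgn_np h ((f r hr).lt_of_ne (mul_ne_zero (right_ne_of_neg h) hrp).symm)
  obtain ⟨y, hy, hyr⟩ := exists_cross (bl hr) hxT hpT hxp
  have hyb := mem_of_openSegment (Or.inr hb) hxb hpb hy
  obtain ⟨r', ⟨hr', hrr', hyr'⟩, -⟩ := Δ.second_segment r hr b hb y hyr hyb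
  have hyE {E} (hE : E ∈ Δ.Sbar) (hx : x ∈ E) (hp : Δ.side E p ≠ 0) : y ∉ E := fun h0 =>
    (side_pos_of_mem_openSegment (openSegment_symm ℝ x p ▸ hy) (side_eq_zero (bl hE) hx) hp).ne'
      (by rw [side_eq_zero (bl hE) h0, mul_zero])
  have hx' : Δ.side r' x ≠ 0 := fun h0 => by
    rcases conc hr' Q.hE₂ Q.hE₃ Q.hE (mem hr' Q.hE₂ Q.hx₂ h0) Q.hx₂ Q.hx₃ with rfl | rfl
    · exact hyE hr' Q.hx₂ Q.side_E₂_p hyr'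
    · exact hyE hr' Q.hx₃ Q.symm.side_E₂_p hyr'
  have hxp' := sep_of_mem_openSegment hy (side_eq_zero (bl hr') hyr') hx'
  have W : Δ.Triple E₂ E₃ s₁ x a₁ b₁ := ⟨Q.hE₂, Q.hE₃, hs₁, Q.hx₂, Q.hx₃, Q.ha₁E, Q.ha₁, Q.hb₁E,
    Q.hb₁, left_ne_of_neg Q.sep₁, Q.symm.side_E₂_ne Q.ha₁E Q.a₁_ne_x,
    Q.side_E₂_ne Q.hb₁E Q.b₁_ne_x⟩
  exact hmin <| HasQuad.mono (W.hasQuad Q.free hr hr' hrr'.symm (cut r hr hxp) (cut r' hr' hxp')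
    (InHull.of_openSegment (inHull_left ..) (InHull.of_openSegment (inHull_mid ..)
      (inHull_right ..) Q.p_mem) hy) hyr hyr') (area_openSegment_le _ Q.a₁_mem)

theorem false_of_mem (hΔ : Δ.Strong) (hmin : ¬ Δ.HasQuad (area x a₂ b₁)) (hE₃ : E₃ ∈ Δ.S) :
    False := by
  obtain ⟨f₁, f₂, f₃⟩ := Q.face_a hΔ hmin
  have hmin' : ¬ Δ.HasQuad (area x b₁ a₂) := by rwa [area_swap]
  obtain ⟨-, g, -⟩ := Q.symm.face_a hΔ hmin'
  have hs₁ := S_subset Q.hs₁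
  have hs₂ := S_subset Q.hs₂
  have L : Δ.Ladder E₂ s₂ s₁ E₃ a₂ a₁ x p b₂ := {
    hE := Q.hE₂, hs := hs₂, hh₁ := hs₁, hh₂ := Q.hE₃, hEs := Q.symm.s₁_ne_E₃.symm
    hAE := Q.ha₂E, hAs := Q.ha₂, hr₁E := Q.ha₁E, hr₂E := Q.hx₂, hq₁s := Q.hp₂, hq₂s := Q.hb₂
    hr₁h := Q.ha₁, hq₁h := Q.hp₁, hr₂h := Q.hx₃, hq₂h := Q.hb₂E
    sepr := swap_neg Q.sep₁, sepq := swap_neg Q.symm.sep_s₂, aAr := f₁, aAq := f₃, arq := f₂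
    arr := (Q.adj_x hΔ hmin).symm, aqq := g.symm, arq' := Q.symm.adj_x hΔ hmin' }
  obtain ⟨A', hA', hA's⟩ := exists_extend hs₂ Q.hE₂ Q.symm.s₁_ne_E₃ Q.ha₂ Q.ha₂E
    (mem_tri (bl hs₁) Q.hb₁) (right_ne_of_neg Q.sep_s₂)
  obtain ⟨y', hy', hy's⟩ := exists_opp hE₃ Q.symm.side_E₂_p
  obtain ⟨y, hy, hys⟩ := exists_extend Q.hE₃ hs₂ Q.symm.s₁_ne_E₂.symm Q.hb₂E Q.hb₂ hy'
    (right_ne_of_neg hy's)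
  exact L.false_of_extend_far hΔ hA' (sgn_pn hA's (swap_neg Q.sep_s₂)) hy
    (sgn_pn hys (swap_neg hy's))

theorem hasQuad (hΔ : Δ.Strong) : Δ.HasQuad (area x a₂ b₁) := by
  by_contra hmin
  obtain ⟨b, hb, -, hxb, -⟩ := Q.exists_diagonal hΔ hmin
  rcases Q.free with h | h | h
  · exact h b hb hxb
  · exact Q.symm.false_of_mem hΔ (by rwa [area_swap]) h
  · exact Q.false_of_mem hΔ hmin h

end Quad

theorem finite_vertex (Δ : TBA) : {v | Δ.IsVertex v}.Finite := by
  have h : {v | Δ.IsVertex v} ⊆ ⋃ s ∈ Δ.Sbar, ⋃ t ∈ Δ.Sbar \ {s}, s ∩ t := by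
    rintro v ⟨s, hs, t, ht, hst, hvs, hvt⟩
    simp only [mem_iUnion]
    exact ⟨s, hs, t, ⟨ht, hst.symm⟩, hvs, hvt⟩
  refine Set.Finite.subset ?_ h
  refine Δ.finite_Sbar.biUnion fun s hs => (Δ.finite_Sbar.subset sdiff_subset).biUnion fun t ht => ?_
  exact Set.Subsingleton.finite fun u hu v hv =>
    eq_of_mem_inter hs ht.1 (fun h => ht.2 h.symm) hu.1 hu.2 hv.1 hv.2

theorem Strong.not_hasQuad (hΔ : Δ.Strong) (K : ℝ) : ¬ Δ.HasQuad K := by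
  set F : Set (Pt × Pt × Pt) := {t | ∃ E₂ E₃ s₁ s₂ a₁ b₂ p,
    Δ.Quad t.1 E₂ E₃ s₁ s₂ a₁ t.2.1 t.2.2 b₂ p}
  have hF : F.Finite := by
    refine (Δ.finite_vertex.prod (Δ.finite_vertex.prod Δ.finite_vertex)).subset ?_
    rintro ⟨x, a₂, b₁⟩ ⟨E₂, E₃, s₁, s₂, a₁, b₂, p, Q⟩
    exact ⟨⟨E₂, Q.hE₂, E₃, Q.hE₃, Q.hE, Q.hx₂, Q.hx₃⟩,
      ⟨s₂, S_subset Q.hs₂, E₂, Q.hE₂, Q.symm.s₁_ne_E₃, Q.ha₂, Q.ha₂E⟩,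
      ⟨s₁, S_subset Q.hs₁, E₃, Q.hE₃, Q.s₁_ne_E₃, Q.hb₁, Q.hb₁E⟩⟩
  rintro ⟨x, E₂, E₃, s₁, s₂, a₁, a₂, b₁, b₂, p, Q, -⟩
  obtain ⟨⟨x, a₂, b₁⟩, ⟨E₂, E₃, s₁, s₂, a₁, b₂, p, Q⟩, hmin⟩ := F.exists_min_image
    (fun t => area t.1 t.2.1 t.2.2) hF ⟨(x, a₂, b₁), E₂, E₃, s₁, s₂, a₁, b₂, p, Q⟩
  obtain ⟨x', E₂', E₃', s₁', s₂', a₁', a₂', b₁', b₂', p', Q', hlt⟩ := Q.hasQuad hΔ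
  exact not_lt.2 (hmin (x', a₂', b₁') ⟨E₂', E₃', s₁', s₂', a₁', b₂', p', Q'⟩) hlt

/-- In a strong arrangement, two chords cutting off an unblocked corner `x` of the triangle
do not meet. -/
theorem Strong.disjoint_chords (hΔ : Δ.Strong) {x : Pt} {E₂ E₃ : Set Pt}
    (hE₂ : E₂ ∈ triEdges Δ.x1 Δ.x2 Δ.x3) (hE₃ : E₃ ∈ triEdges Δ.x1 Δ.x2 Δ.x3) (hE : E₂ ≠ E₃)
    (hx₂ : x ∈ E₂) (hx₃ : x ∈ E₃) (hx : ∀ b ∈ Δ.B, x ∉ b) {a a' b b' : Pt} (ha : a ∈ E₂)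
    (ha' : a' ∈ E₂) (hb : b ∈ E₃) (hb' : b' ∈ E₃) (hs : segment ℝ a b ∈ Δ.S)
    (hs' : segment ℝ a' b' ∈ Δ.S) (hne : segment ℝ a b ≠ segment ℝ a' b') :
    Disjoint (segment ℝ a b) (segment ℝ a' b') := by
  rw [Set.disjoint_left]
  intro p hp hp'
  have e₂ := triEdges_subset hE₂
  have e₃ := triEdges_subset hE₃
  have nE {s e} (hs : s ∈ Δ.S) (he : e ∈ triEdges Δ.x1 Δ.x2 Δ.x3) : s ≠ e := fun h =>
    S_notMem_triEdges hs (h ▸ he)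
  have nx {s} (hs : s ∈ Δ.S) : x ∉ s := fun h =>
    (conc (S_subset hs) e₂ e₃ hE h hx₂ hx₃).elim (nE hs hE₂) (nE hs hE₃)
  have disj {e} (he : e ∈ triEdges Δ.x1 Δ.x2 Δ.x3) {v} (hv : v ∈ segment ℝ a b)
      (hv' : v ∈ segment ℝ a' b') : v ∉ e := fun h =>
    (conc (triEdges_subset he) (S_subset hs) (S_subset hs') hne h hv hv').elim
      (nE hs he ·.symm) (nE hs' he ·.symm)
  have extreme {e f} (he : e ∈ triEdges Δ.x1 Δ.x2 Δ.x3) (hf : f ∈ triEdges Δ.x1 Δ.x2 Δ.x3)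
      (hef : f ≠ e) (hxe : x ∈ e) (hxf : x ∈ f) {u v} (hu : u ∈ e) (hv : v ∈ e) (hux : u ≠ x) :
      x ∉ openSegment ℝ u v := fun h => notMem_triEdges_of_sep
    (mem_tri (bl (triEdges_subset he)) hu) (mem_tri (bl (triEdges_subset he)) hv)
    (sep_of_mem_openSegment h (side_eq_zero (bl (triEdges_subset hf)) hxf) (side_ne_zero
      (triEdges_subset he) (triEdges_subset hf) hef.symm hxe hxf hu hux)) hf
  have key : ∀ {a a' b b' : Pt}, a ∈ E₂ → a' ∈ E₂ → b ∈ E₃ → b' ∈ E₃ → segment ℝ a b ∈ Δ.S →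
      segment ℝ a' b' ∈ Δ.S → p ∈ segment ℝ a b → p ∈ segment ℝ a' b' →
      b' ∉ segment ℝ a b → a ∈ openSegment ℝ x a' → False := by
    intro a a' b b' ha ha' hb hb' hs hs' hp hp' hbb h
    have sa := left_mem_segment ℝ a b
    have sa' := left_mem_segment ℝ a' b'
    have sb := right_mem_segment ℝ a b
    have sb' := right_mem_segment ℝ a' b'
    have hS := bl (S_subset hs)
    have hxn {s} (hs : s ∈ Δ.S) : Δ.side s x ≠ 0 := fun h0 =>
      nx hs (mem_of_side_eq_zero (bl (S_subset hs)) (mem_tri (bl e₂) hx₂) h0)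
    have h1 := sep_of_mem_openSegment h (side_eq_zero hS sa) (hxn hs)
    have hpa : a' ≠ p := by
      rintro rfl
      exact right_ne_of_neg h1 (side_eq_zero hS hp)
    have hbp : b' ≠ p := by
      rintro rfl
      exact hbb hp
    have h2 := sep_of_mem_openSegment (mem_openSegment_of_ne_left_right hpa
      hbp hp') (side_eq_zero hS hp) (right_ne_of_neg h1)
    have h3 := sgn_nn h1 h2
    have hbx : b ≠ x := fun h0 => nx hs (h0 ▸ sb)
    have hbx' : b' ≠ x := fun h0 => nx hs' (h0 ▸ sb')
    rcases openSegment_trichotomy e₃ hx₃ hb' hb hbx'.symm (fun h0 => hbb (h0 ▸ sb)) hbx.symm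
      with h4 | h4 | h4
    · exact hΔ.not_hasQuad _ ⟨x, E₂, E₃, _, _, a, a', b, b', p, ⟨e₂, e₃, hs, hs', hE, hx₂, hx₃,
        sa, ha, sa', ha', sb, hb, sb', hb', hp, hp', h1, sep_of_mem_openSegment h4
          (side_eq_zero (bl (S_subset hs')) sb') (hxn hs'), Or.inl hx⟩, lt_add_one _⟩
    · exact lt_asymm (swap_pos h3)
        (sep_of_mem_openSegment h4 (side_eq_zero hS sb) (right_ne_of_pos h3))
    · exact extreme hE₃ hE₂ hE hx₃ hx₂ hb hb' hbx h4
  have hax : a ≠ x := fun h0 => nx hs (h0 ▸ left_mem_segment ℝ a b)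
  have hax' : a' ≠ x := fun h0 => nx hs' (h0 ▸ left_mem_segment ℝ a' b')
  have haa : a ≠ a' := fun h0 =>
    disj hE₂ (left_mem_segment ℝ a b) (h0 ▸ left_mem_segment ℝ a' b') ha
  rcases openSegment_trichotomy e₂ hx₂ ha ha' hax.symm haa hax'.symm with h | h | h
  · exact key ha ha' hb hb' hs hs' hp hp'
      (fun h0 => disj hE₃ h0 (right_mem_segment ℝ a' b') hb') h
  · exact key ha' ha hb' hb hs' hs hp' hp (disj hE₃ (right_mem_segment ℝ a b) · hb)
      (openSegment_symm ℝ a x ▸ h)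
  · exact extreme hE₂ hE₃ hE.symm hx₂ hx₃ ha' ha hax' h

end TBA

/-- Proposition 8: in a strong triangle blocking arrangement in which no blocking segment
passes through `x₁`, any two proper initial segments with one endpoint on `x₁x₂` and the
other on `x₁x₃` are disjoint. -/
theorem TBA.forbidden_structure_1 (Δ : TBA) (hstrong : Δ.Strong)
    (hx1 : ∀ b ∈ Δ.B, Δ.x1 ∉ b)
    (s₁ s₂ : Set Pt) (hs₁ : s₁ ∈ Δ.S) (hs₂ : s₂ ∈ Δ.S) (hne : s₁ ≠ s₂)
    (h₁ : ∃ a ∈ segment ℝ Δ.x1 Δ.x2, ∃ b ∈ segment ℝ Δ.x1 Δ.x3, s₁ = segment ℝ a b)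
    (h₂ : ∃ a ∈ segment ℝ Δ.x1 Δ.x2, ∃ b ∈ segment ℝ Δ.x1 Δ.x3, s₂ = segment ℝ a b) :
    Disjoint s₁ s₂ := by
  obtain ⟨a, ha, b, hb, rfl⟩ := h₁
  obtain ⟨a', ha', b', hb', rfl⟩ := h₂
  rw [segment_symm ℝ Δ.x1 Δ.x3] at hb hb'
  have hE₂ : segment ℝ Δ.x1 Δ.x2 ∈ triEdges Δ.x1 Δ.x2 Δ.x3 := Or.inl rfl
  have hE₃ : segment ℝ Δ.x3 Δ.x1 ∈ triEdges Δ.x1 Δ.x2 Δ.x3 := Or.inr (Or.inr rfl)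
  refine hstrong.disjoint_chords hE₂ hE₃ (fun h => ?_) (left_mem_segment ..)
    (right_mem_segment ..) hx1 ha ha' hb hb' hs₁ hs₂ hne
  have hE := TBA.bl (TBA.triEdges_subset hE₃)
  exact TBA.side_vertices_ne hE (TBA.side_eq_zero hE (right_mem_segment ..))
    (TBA.side_eq_zero hE (h ▸ right_mem_segment ..)) (TBA.side_eq_zero hE (left_mem_segment ..))
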